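/- arXiv:math/0110178 — 2 statements merged into one kernel-verified Lean document; each statement's English description precedes it below -/
import Mathlib

section
/- Let a_n be the number of Carlitz compositions of n and a_{n,j} the number of Carlitz compositions of n with no part equal to j. Let ρ be the unique real solution of σ(z) = 1 in (0,1) and set α = 1/σ'(ρ). Then, as n → ∞, ∑_{j=1}^{n} (1 - a_{n,j}/a_n) - ∑_{j=0}^{∞} (1 - (1 - ρ^j α)^n) → 0. -/
open Filter

/-- A list of natural numbers is a composition of `n` if all its entries are
positive and they sum to `n`. -/
def IsComposition (n : ℕ) (L : List ℕ) : Prop :=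
  (∀ x ∈ L, 0 < x) ∧ L.sum = n

/-- A composition is Carlitz if adjacent parts are different. -/
def IsCarlitz (L : List ℕ) : Prop :=
  L.Chain' (· ≠ ·)

/-- `carlitzCount n` is the number of Carlitz compositions of `n`. -/
noncomputable def carlitzCount (n : ℕ) : ℕ :=
  Nat.card {L : List ℕ // IsComposition n L ∧ IsCarlitz L}

/-- `carlitzCountAvoid n j` is the number of Carlitz compositions of `n`
having no part equal to `j`. -/
noncomputable def carlitzCountAvoid (n j : ℕ) : ℕ :=
  Nat.card {L : List ℕ // IsComposition n L ∧ IsCarlitz L ∧ j ∉ L}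

/-- `σ(z) = ∑_{ℓ≥1} (-1)^{ℓ-1} z^ℓ/(1-z^ℓ)` for real `z`. -/
noncomputable def sigmaFn (z : ℝ) : ℝ :=
  ∑' ℓ : ℕ, (-1 : ℝ) ^ ℓ * z ^ (ℓ + 1) / (1 - z ^ (ℓ + 1))

/-- Carlitz compositions of `n` with allowed parts `T`. -/
def CC (T : ℕ → Prop) (n : ℕ) : Set (List ℕ) :=
  {L | IsComposition n L ∧ IsCarlitz L ∧ ∀ x ∈ L, T x}

noncomputable def cT (T : ℕ → Prop) (n : ℕ) : ℕ := (CC T n).ncard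

noncomputable def fT (T : ℕ → Prop) (i n : ℕ) : ℕ :=
  ({L | L ∈ CC T n ∧ L.head? = some i}).ncard

lemma comp_finite (n : ℕ) : {L : List ℕ | IsComposition n L}.Finite := by
  refine Set.Finite.subset (Set.finite_range (fun c : Composition n => c.blocks)) ?_
  rintro L ⟨h1, h2⟩
  exact ⟨⟨L, fun {i} hi => h1 i hi, h2⟩, rfl⟩

lemma CC_finite (T : ℕ → Prop) (n : ℕ) : (CC T n).Finite :=
  (comp_finite n).subset (fun _ h => h.1)

lemma cT_mono {T U : ℕ → Prop} (h : ∀ x, T x → U x) (n : ℕ) : cT T n ≤ cT U n :=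
  Set.ncard_le_ncard (fun _ hL => ⟨hL.1, hL.2.1, fun x hx => h x (hL.2.2 x hx)⟩) (CC_finite U n)

lemma carlitzCount_eq (n : ℕ) : carlitzCount n = cT (fun _ => True) n := by
  unfold carlitzCount cT CC
  rw [← Nat.card_coe_set_eq]
  refine Nat.card_congr (Equiv.subtypeEquivRight ?_)
  intro L
  simp

lemma carlitzCountAvoid_eq (n j : ℕ) : carlitzCountAvoid n j = cT (fun x => x ≠ j) n := by
  unfold carlitzCountAvoid cT CC
  rw [← Nat.card_coe_set_eq]
  refine Nat.card_congr (Equiv.subtypeEquivRight ?_)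
  intro L
  simp only [Set.mem_ofPred_eq]
  constructor
  · rintro ⟨a, b, c⟩
    exact ⟨a, b, fun x hx h => c (h ▸ hx)⟩
  · rintro ⟨a, b, c⟩
    exact ⟨a, b, fun h => c j h rfl⟩

lemma fT_rec {T : ℕ → Prop} {i : ℕ} (hi : 0 < i) (hT : T i) (n : ℕ) :
    fT T i (n + i) + fT T i n = cT T n := by
  have h1 : {L | L ∈ CC T (n + i) ∧ L.head? = some i}
      = (fun L => i :: L) '' {L | L ∈ CC T n ∧ L.head? ≠ some i} := by
    ext L
    simp only [Set.mem_ofPred_eq, Set.mem_image]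
    constructor
    · rintro ⟨⟨⟨h1, h2⟩, h3, h4⟩, h5⟩
      cases L with
      | nil => simp at h5
      | cons a L =>
        simp only [List.head?_cons, Option.some.injEq] at h5
        subst h5
        refine ⟨L, ⟨⟨⟨fun x hx => h1 x (by simp [hx]), ?_⟩, ?_, fun x hx => h4 x (by simp [hx])⟩, ?_⟩, rfl⟩
        · simp at h2; omega
        · unfold IsCarlitz at *
          exact (List.isChain_cons.1 h3).2
        · intro h
          exact (List.isChain_cons.1 h3).1 a (by simp [h]) rfl
    · rintro ⟨M, ⟨⟨⟨h1, h2⟩, h3, h4⟩, h5⟩, rfl⟩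
      refine ⟨⟨⟨?_, ?_⟩, ?_, ?_⟩, by simp⟩
      · simpa using ⟨hi, h1⟩
      · simp; omega
      · unfold IsCarlitz at *
        refine List.isChain_cons.2 ⟨?_, h3⟩
        rintro y hy rfl
        exact h5 hy
      · simpa using ⟨hT, h4⟩
  unfold fT cT
  rw [h1, Set.ncard_image_of_injective _ (List.cons_injective), ← Set.ncard_union_eq ?_ ?_ ?_]
  · congr 1
    ext L
    simp only [Set.mem_union, Set.mem_ofPred_eq]
    tauto
  · rw [Set.disjoint_left]
    rintro L ⟨_, h⟩ ⟨_, h'⟩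
    exact h h'
  · exact (CC_finite T n).subset (fun _ h => h.1)
  · exact (CC_finite T n).subset (fun _ h => h.1)

lemma fT_zero_of_lt {T : ℕ → Prop} {i n : ℕ} (h : n < i) : fT T i n = 0 := by
  unfold fT
  convert Set.ncard_empty (List ℕ)
  ext L
  simp only [Set.mem_ofPred_eq, Set.mem_empty_iff_false, iff_false, not_and]
  rintro ⟨⟨h1, h2⟩, h3, h4⟩ h5
  cases L with
  | nil => simp at h5
  | cons a L =>
    simp at h5 h2
    omega

lemma fT_zero_of_not {T : ℕ → Prop} {i n : ℕ} (h : ¬ T i) : fT T i n = 0 := by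
  unfold fT
  convert Set.ncard_empty (List ℕ)
  ext L
  simp only [Set.mem_ofPred_eq, Set.mem_empty_iff_false, iff_false, not_and]
  rintro ⟨⟨h1, h2⟩, h3, h4⟩ h5
  cases L with
  | nil => simp at h5
  | cons a L =>
    simp at h5
    subst h5
    exact h (h4 a (by simp))

lemma cT_zero (T : ℕ → Prop) : cT T 0 = 1 := by
  unfold cT
  rw [Set.ncard_eq_one]
  refine ⟨[], ?_⟩
  ext L
  simp only [CC, IsComposition, IsCarlitz, Set.mem_ofPred_eq, Set.mem_singleton_iff]
  constructor
  · rintro ⟨⟨h1, h2⟩, h3, h4⟩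
    cases L with
    | nil => rfl
    | cons a L =>
      have := h1 a (by simp)
      simp at h2
      omega
  · rintro rfl
    exact ⟨by simp, List.isChain_nil, by simp⟩

lemma cT_eq_sum (T : ℕ → Prop) (n : ℕ) :
    cT T n = (if n = 0 then 1 else 0) + ∑ i ∈ Finset.range n, fT T (i + 1) n := by
  rcases Nat.eq_zero_or_pos n with rfl | hn
  · simp [cT_zero]
  · rw [if_neg hn.ne', zero_add]
    have : CC T n = ⋃ i ∈ Finset.range n, {L | L ∈ CC T n ∧ L.head? = some (i + 1)} := by
      ext L
      simp only [Set.mem_iUnion, Set.mem_ofPred_eq, Finset.mem_range, exists_prop]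
      constructor
      · intro h
        have h' := h
        obtain ⟨⟨h1, h2⟩, h3, h4⟩ := h
        cases L with
        | nil => simp at h2; omega
        | cons a L =>
          have := h1 a (by simp)
          simp at h2
          refine ⟨a - 1, by omega, h', ?_⟩
          simp; omega
      · rintro ⟨i, _, h, _⟩
        exact h
    unfold cT
    conv_lhs => rw [this]
    have key : ∀ s : Finset ℕ, (⋃ i ∈ s, {L | L ∈ CC T n ∧ L.head? = some (i + 1)}).ncard
        = ∑ i ∈ s, fT T (i + 1) n := by
      intro s
      induction s using Finset.induction_on with
      | empty => simp
      | insert a s ha ih =>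
        rw [Finset.sum_insert ha, ← ih, Finset.set_biUnion_insert, Set.ncard_union_eq ?_ ?_ ?_]
        · rfl
        · rw [Set.disjoint_left]
          rintro L ⟨_, h⟩ h'
          simp only [Set.mem_iUnion, Set.mem_ofPred_eq, exists_prop] at h'
          obtain ⟨i, hi, _, h2⟩ := h'
          rw [h] at h2
          simp at h2
          exact ha (h2 ▸ hi)
        · exact (CC_finite T n).subset (fun _ h => h.1)
        · refine (CC_finite T n).subset ?_
          intro L h
          simp only [Set.mem_iUnion, Set.mem_ofPred_eq, exists_prop] at h
          obtain ⟨i, _, h, _⟩ := h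
          exact h
    exact key _

lemma cT_pos_single {T : ℕ → Prop} {n : ℕ} (hn : 0 < n) (h : T n) : 1 ≤ cT T n := by
  unfold cT
  rw [Nat.one_le_iff_ne_zero, ← Nat.pos_iff_ne_zero, Set.ncard_pos (CC_finite T n)]
  refine ⟨[n], ⟨?_, ?_⟩, ?_, ?_⟩
  · simpa using hn
  · simp
  · exact List.isChain_singleton _
  · simpa using h

lemma cT_avoid_large {n j : ℕ} (h : n < j) : cT (fun x => x ≠ j) n = cT (fun _ => True) n := by
  unfold cT
  congr 1
  ext L
  simp only [CC, IsComposition, Set.mem_ofPred_eq]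
  constructor
  · rintro ⟨a, b, _⟩
    exact ⟨a, b, fun _ _ => trivial⟩
  · rintro ⟨a, b, _⟩
    refine ⟨a, b, fun x hx => ?_⟩
    have := List.le_sum_of_mem hx
    omega

open Classical in
noncomputable def tt {K : Type*} [NormedField K] (T : ℕ → Prop) (i : ℕ) (z : K) : K :=
  if T (i + 1) then z ^ (i + 1) / (1 + z ^ (i + 1)) else 0

noncomputable def sT {K : Type*} [NormedField K] (T : ℕ → Prop) (z : K) : K :=
  ∑' i : ℕ, tt T i z

lemma tt_norm_le {K : Type*} [NormedField K] (T : ℕ → Prop) (i : ℕ) (z : K) {r : ℝ}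
    (hz : ‖z‖ ≤ r) (hr : r < 1) : ‖tt T i z‖ ≤ r ^ (i + 1) * (1 - r)⁻¹ := by
  have hr0 : 0 ≤ r := (norm_nonneg z).trans hz
  have h1r : 0 < 1 - r := by linarith
  unfold tt
  split_ifs with h
  · rw [norm_div, norm_pow, div_eq_mul_inv]
    have h1 : ‖z‖ ^ (i + 1) ≤ r ^ (i + 1) := pow_le_pow_left₀ (norm_nonneg _) hz _
    have h2 : r ^ (i + 1) ≤ r := by
      calc r ^ (i + 1) = r ^ i * r := pow_succ _ _
        _ ≤ 1 * r := by
          apply mul_le_mul_of_nonneg_right (pow_le_one₀ hr0 hr.le) hr0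
        _ = r := one_mul r
    have h3 : 1 - r ≤ ‖1 + z ^ (i + 1)‖ := by
      have := norm_sub_norm_le (1 : K) (-(z ^ (i + 1)))
      rw [norm_one, norm_neg, norm_pow, sub_neg_eq_add] at this
      linarith
    gcongr
  · simp; positivity

lemma tt_summable {K : Type*} [NormedField K] (T : ℕ → Prop) (z : K) (hz : ‖z‖ < 1) :
    Summable (fun i => ‖tt T i z‖) := by
  refine Summable.of_nonneg_of_le (fun _ => norm_nonneg _)
    (fun i => tt_norm_le T i z le_rfl hz) ?_
  apply Summable.mul_right
  exact (summable_nat_add_iff 1).2 (summable_geometric_of_lt_one (norm_nonneg _) hz)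

lemma tt_nonneg (T : ℕ → Prop) (i : ℕ) {x : ℝ} (hx : 0 ≤ x) : 0 ≤ tt T i x := by
  unfold tt
  split_ifs <;> positivity

lemma tt_summable' (T : ℕ → Prop) {x : ℝ} (hx : 0 ≤ x) (hx1 : x < 1) :
    Summable (fun i => tt T i x) := by
  apply Summable.of_norm
  exact tt_summable T x (by rwa [Real.norm_of_nonneg hx])

lemma fT_bound (T : ℕ → Prop) {x : ℝ} (hx : 0 < x) (hx1 : x < 1) (hs : sT T x < 1) :
    ∀ N i : ℕ, ∑ n ∈ Finset.range N, (fT T (i + 1) n : ℝ) * x ^ n ≤ tt T i x * (1 / (1 - sT T x)) := by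
  intro N
  induction N using Nat.strong_induction_on with
  | _ N ih =>
  intro i
  have hA : 0 < 1 / (1 - sT T x) := by
    apply one_div_pos.2; linarith
  have hAeq : 1 + sT T x * (1 / (1 - sT T x)) = 1 / (1 - sT T x) := by
    have : 1 - sT T x ≠ 0 := by linarith
    field_simp
    ring
  set A := 1 / (1 - sT T x) with hAdef
  by_cases hT : T (i + 1)
  swap
  · simp only [fT_zero_of_not hT, Nat.cast_zero, zero_mul, Finset.sum_const_zero]
    exact mul_nonneg (tt_nonneg _ _ hx.le) hA.le
  rcases le_total N (i + 1) with hN | hN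
  · rw [Finset.sum_eq_zero]
    · exact mul_nonneg (tt_nonneg _ _ hx.le) hA.le
    · intro n hn
      rw [fT_zero_of_lt (by have := Finset.mem_range.1 hn; omega)]
      simp
  · obtain ⟨M, rfl⟩ := Nat.exists_eq_add_of_le hN
    rw [Finset.sum_range_add, Finset.sum_eq_zero, zero_add]
    swap
    · intro n hn
      rw [fT_zero_of_lt (by have := Finset.mem_range.1 hn; omega)]
      simp
    have e1 : ∀ n ∈ Finset.range M, (fT T (i + 1) (i + 1 + n) : ℝ) * x ^ (i + 1 + n)
        ≤ x ^ (i + 1) * ((if n = 0 then 1 else 0) * x ^ n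
            + ∑ l ∈ (Finset.range M).erase i, (fT T (l + 1) n : ℝ) * x ^ n) := by
      intro n hn
      have h1 := fT_rec (T := T) (Nat.succ_pos i) hT n
      have h2 := cT_eq_sum T n
      have h2' : ∑ l ∈ Finset.range n, fT T (l + 1) n ≤
          ∑ l ∈ (Finset.range M).erase i, fT T (l + 1) n + fT T (i + 1) n := by
        calc ∑ l ∈ Finset.range n, fT T (l + 1) n
            ≤ ∑ l ∈ insert i ((Finset.range M).erase i), fT T (l + 1) n := by
              apply Finset.sum_le_sum_of_subset
              intro l hl
              simp only [Finset.mem_insert, Finset.mem_erase, Finset.mem_range] at *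
              omega
          _ = _ := by
              rw [Finset.sum_insert (by simp)]
              omega
      have h3 : fT T (i + 1) (i + 1 + n) ≤ (if n = 0 then 1 else 0) +
          ∑ l ∈ (Finset.range M).erase i, fT T (l + 1) n := by
        rw [add_comm (i + 1) n]
        simp only [Nat.succ_eq_add_one] at h1
        omega
      have h4 : (fT T (i + 1) (i + 1 + n) : ℝ) ≤ (if n = 0 then 1 else 0) +
          ∑ l ∈ (Finset.range M).erase i, (fT T (l + 1) n : ℝ) := by
        exact_mod_cast h3
      rw [← Finset.sum_mul, ← add_mul, pow_add]
      calc _ ≤ ((if n = 0 then 1 else 0) +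
          ∑ l ∈ (Finset.range M).erase i, (fT T (l + 1) n : ℝ)) * (x ^ (i + 1) * x ^ n) := by
            gcongr
        _ = _ := by ring
    refine (Finset.sum_le_sum e1).trans ?_
    rw [← Finset.mul_sum, Finset.sum_add_distrib, Finset.sum_comm]
    have e2 : ∑ n ∈ Finset.range M, (if n = 0 then (1 : ℝ) else 0) * x ^ n ≤ 1 := by
      calc ∑ n ∈ Finset.range M, (if n = 0 then (1 : ℝ) else 0) * x ^ n
          ≤ ∑ n ∈ Finset.range (M + 1), (if n = 0 then (1 : ℝ) else 0) * x ^ n := by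
            apply Finset.sum_le_sum_of_subset_of_nonneg
            · intro l hl; simp at *; omega
            · intros; positivity
        _ = 1 := by
            simp
    have e3 : ∑ l ∈ (Finset.range M).erase i, ∑ n ∈ Finset.range M, (fT T (l + 1) n : ℝ) * x ^ n
        ≤ (sT T x - tt T i x) * A := by
      calc _ ≤ ∑ l ∈ (Finset.range M).erase i, tt T l x * A :=
            Finset.sum_le_sum fun l _ => ih M (by omega) l
        _ = (∑ l ∈ (Finset.range M).erase i, tt T l x) * A := by rw [Finset.sum_mul]
        _ ≤ _ := by
          gcongr
          have : ∑ l ∈ insert i ((Finset.range M).erase i), tt T l x ≤ sT T x :=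
            (tt_summable' T hx.le hx1).sum_le_tsum _ (fun l _ => tt_nonneg T l hx.le)
          rw [Finset.sum_insert (by simp)] at this
          linarith
    have e4 : x ^ (i + 1) * (1 + (sT T x - tt T i x) * A) = tt T i x * A := by
      have : 1 + (sT T x - tt T i x) * A = A - tt T i x * A := by linarith
      rw [this]
      unfold tt
      rw [if_pos hT]
      have : 1 + x ^ (i + 1) ≠ 0 := by positivity
      field_simp
      ring
    rw [← e4]
    gcongr

lemma cT_bound (T : ℕ → Prop) {x : ℝ} (hx : 0 < x) (hx1 : x < 1) (hs : sT T x < 1) (N : ℕ) :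
    ∑ n ∈ Finset.range N, (cT T n : ℝ) * x ^ n ≤ 1 / (1 - sT T x) := by
  have hA : 0 < 1 / (1 - sT T x) := by
    apply one_div_pos.2; linarith
  have hAeq : 1 + sT T x * (1 / (1 - sT T x)) = 1 / (1 - sT T x) := by
    have : 1 - sT T x ≠ 0 := by linarith
    field_simp
    ring
  calc ∑ n ∈ Finset.range N, (cT T n : ℝ) * x ^ n
      ≤ ∑ n ∈ Finset.range N, ((if n = 0 then 1 else 0) * x ^ n
          + ∑ l ∈ Finset.range N, (fT T (l + 1) n : ℝ) * x ^ n) := by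
        apply Finset.sum_le_sum
        intro n hn
        rw [← Finset.sum_mul, ← add_mul]
        gcongr
        rw [cT_eq_sum]
        push_cast
        gcongr
        simpa using (Finset.mem_range.1 hn).le
    _ = ∑ n ∈ Finset.range N, (if n = 0 then (1 : ℝ) else 0) * x ^ n
          + ∑ l ∈ Finset.range N, ∑ n ∈ Finset.range N, (fT T (l + 1) n : ℝ) * x ^ n := by
        rw [Finset.sum_add_distrib, Finset.sum_comm (s := Finset.range N) (t := Finset.range N)]
    _ ≤ 1 + sT T x * (1 / (1 - sT T x)) := by
        gcongr
        · calc ∑ n ∈ Finset.range N, (if n = 0 then (1 : ℝ) else 0) * x ^ n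
              ≤ ∑ n ∈ Finset.range (N + 1), (if n = 0 then (1 : ℝ) else 0) * x ^ n := by
                apply Finset.sum_le_sum_of_subset_of_nonneg
                · intro l hl; simp at *; omega
                · intros; positivity
            _ = 1 := by
                simp
        · calc _ ≤ ∑ l ∈ Finset.range N, tt T l x * (1 / (1 - sT T x)) :=
                Finset.sum_le_sum fun l _ => fT_bound T hx hx1 hs N l
            _ = (∑ l ∈ Finset.range N, tt T l x) * (1 / (1 - sT T x)) := by rw [Finset.sum_mul]
            _ ≤ _ := by
              gcongr
              exact (tt_summable' T hx.le hx1).sum_le_tsum _ (fun l _ => tt_nonneg T l hx.le)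
    _ = _ := hAeq

lemma cT_summable (T : ℕ → Prop) {x : ℝ} (hx : 0 < x) (hx1 : x < 1) (hs : sT T x < 1) :
    Summable (fun n => (cT T n : ℝ) * x ^ n) :=
  summable_of_sum_range_le (fun _ => by positivity) (cT_bound T hx hx1 hs)

lemma cT_tsum_le (T : ℕ → Prop) {x : ℝ} (hx : 0 < x) (hx1 : x < 1) (hs : sT T x < 1) :
    ∑' n, (cT T n : ℝ) * x ^ n ≤ 1 / (1 - sT T x) :=
  Real.tsum_le_of_sum_range_le (fun _ => by positivity) (cT_bound T hx hx1 hs)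

/-- The generating function identity evaluated at a complex point. -/
lemma gf_identity (T : ℕ → Prop) (z : ℂ) (hz : ‖z‖ < 1)
    (hsum : Summable (fun n => (cT T n : ℝ) * ‖z‖ ^ n)) :
    (∑' n, (cT T n : ℂ) * z ^ n) * (1 - sT T z) = 1 := by
  have hfle : ∀ i n, fT T i n ≤ cT T n := fun i n =>
    Set.ncard_le_ncard (fun _ h => h.1) (CC_finite T n)
  set A := ∑' n, (cT T n : ℂ) * z ^ n with hA
  have hsA : Summable (fun n => (cT T n : ℂ) * z ^ n) := by
    apply Summable.of_norm
    simpa using hsum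
  have hsF : ∀ i, Summable (fun n => (fT T i n : ℂ) * z ^ n) := by
    intro i
    apply Summable.of_norm
    refine Summable.of_nonneg_of_le (fun _ => norm_nonneg _) (fun n => ?_) hsum
    simp only [norm_mul, Complex.norm_natCast, norm_pow]
    gcongr
    exact hfle i n
  have hF : ∀ i, ∑' n, (fT T (i + 1) n : ℂ) * z ^ n = tt T i z * A := by
    intro i
    by_cases hT : T (i + 1)
    swap
    · simp [tt, hT, fT_zero_of_not hT]
    have h1 : ∑' n, (fT T (i + 1) n : ℂ) * z ^ n
        = ∑' n, (fT T (i + 1) (n + (i + 1)) : ℂ) * z ^ (n + (i + 1)) := by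
      rw [← (hsF (i + 1)).sum_add_tsum_nat_add (i + 1), Finset.sum_eq_zero, zero_add]
      intro n hn
      rw [fT_zero_of_lt (by have := Finset.mem_range.1 hn; omega)]
      simp
    have h2 : ∑' n, (fT T (i + 1) (n + (i + 1)) : ℂ) * z ^ (n + (i + 1))
        = z ^ (i + 1) * A - z ^ (i + 1) * ∑' n, (fT T (i + 1) n : ℂ) * z ^ n := by
      rw [hA, ← tsum_mul_left, ← tsum_mul_left, ← Summable.tsum_sub (hsA.mul_left _) ((hsF _).mul_left _)]
      congr 1
      ext n
      rw [← fT_rec (T := T) (Nat.succ_pos i) hT n]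
      push_cast
      ring
    rw [h2] at h1
    have hne : 1 + z ^ (i + 1) ≠ 0 := by
      intro h
      have h' : z ^ (i + 1) = -1 := by linear_combination h
      have := congrArg norm h'
      rw [norm_pow, norm_neg, norm_one] at this
      have h3 : ‖z‖ ^ (i + 1) < 1 := pow_lt_one₀ (norm_nonneg _) hz (by omega)
      linarith
    unfold tt
    rw [if_pos hT]
    field_simp
    linear_combination h1
  have hsum2 : Summable (Function.uncurry fun (n i : ℕ) => (fT T (i + 1) n : ℂ) * z ^ n) := by
    apply Summable.of_norm
    rw [summable_prod_of_nonneg (fun _ => norm_nonneg _)]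
    have hfin : ∀ n, ∀ i ∉ Finset.range n, ‖(fT T (i + 1) n : ℂ) * z ^ n‖ = 0 := by
      intro n i hi
      rw [fT_zero_of_lt (by simp at hi; omega)]
      simp
    constructor
    · intro n
      exact summable_of_ne_finset_zero (hfin n)
    · refine Summable.of_nonneg_of_le (fun _ => tsum_nonneg fun _ => norm_nonneg _) (fun n => ?_) hsum
      simp only [Function.uncurry_apply_pair]
      rw [tsum_eq_sum (hfin n)]
      simp only [norm_mul, Complex.norm_natCast, norm_pow]
      rw [← Finset.sum_mul]
      gcongr
      have := cT_eq_sum T n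
      exact_mod_cast (by omega : ∑ i ∈ Finset.range n, fT T (i + 1) n ≤ cT T n)
  have hmain : A = 1 + ∑' i, tt T i z * A := by
    calc A = ∑' n, ((if n = 0 then 1 else 0) + ∑' i, (fT T (i + 1) n : ℂ) * z ^ n) := by
          rw [hA]
          congr 1
          ext n
          rw [tsum_eq_sum (s := Finset.range n), ← Finset.sum_mul, cT_eq_sum]
          · push_cast
            rcases Nat.eq_zero_or_pos n with rfl | h
            · simp
            · simp [h.ne']
          · intro i hi
            rw [fT_zero_of_lt (by simp at hi; omega)]
            simp
      _ = 1 + ∑' n, ∑' i, (fT T (i + 1) n : ℂ) * z ^ n := by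
          rw [Summable.tsum_add]
          · simp
          · exact summable_of_ne_finset_zero (s := {0}) (by intro b hb; simp at hb; simp [hb])
          · exact hsum2.prod
      _ = 1 + ∑' i, ∑' n, (fT T (i + 1) n : ℂ) * z ^ n := by
          rw [hsum2.tsum_comm]
      _ = _ := by simp only [hF]
  rw [tsum_mul_right] at hmain
  unfold sT
  linear_combination hmain

lemma sigma_eq {x : ℝ} (hx : 0 ≤ x) (hx1 : x < 1) : sigmaFn x = sT (fun _ => True) x := by
  have hpow : ∀ l : ℕ, x ^ (l + 1) < 1 := fun l => pow_lt_one₀ hx hx1 (by omega)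
  have hpow0 : ∀ l : ℕ, 0 ≤ x ^ (l + 1) := fun l => by positivity
  have hsum : Summable (Function.uncurry fun (l i : ℕ) => (-1 : ℝ) ^ l * (x ^ (l + 1)) ^ (i + 1)) := by
    apply Summable.of_norm
    have hg := summable_geometric_of_lt_one hx hx1
    refine Summable.of_nonneg_of_le (fun _ => norm_nonneg _) ?_
      (hg.mul_of_nonneg hg (fun _ => by positivity) (fun _ => by positivity))
    rintro ⟨l, i⟩
    simp only [Function.uncurry_apply_pair, norm_mul, norm_pow, norm_neg, norm_one, one_pow, one_mul,
      Real.norm_of_nonneg hx]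
    rw [← pow_mul, ← pow_add]
    exact pow_le_pow_of_le_one hx hx1.le (by nlinarith)
  have h1 : ∀ l : ℕ, (-1 : ℝ) ^ l * x ^ (l + 1) / (1 - x ^ (l + 1))
      = ∑' i : ℕ, (-1 : ℝ) ^ l * (x ^ (l + 1)) ^ (i + 1) := by
    intro l
    simp only [pow_succ (x ^ (l + 1))]
    rw [tsum_mul_left, tsum_mul_right, tsum_geometric_of_lt_one (hpow0 l) (hpow l)]
    field_simp
  have h2 : ∀ i : ℕ, tt (fun _ => True) i x = ∑' l : ℕ, (-1 : ℝ) ^ l * (x ^ (l + 1)) ^ (i + 1) := by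
    intro i
    have : ∀ l : ℕ, (-1 : ℝ) ^ l * (x ^ (l + 1)) ^ (i + 1) = (-x ^ (i + 1)) ^ l * x ^ (i + 1) := by
      intro l
      rw [neg_pow (x ^ (i + 1)) l]
      ring
    simp only [this]
    rw [tsum_mul_right, tsum_geometric_of_norm_lt_one]
    · simp only [tt, if_true]
      rw [sub_neg_eq_add, div_eq_mul_inv, mul_comm]
    · rw [norm_neg, Real.norm_of_nonneg (hpow0 i)]
      exact hpow i
  unfold sigmaFn sT
  simp only [h1, h2]
  exact hsum.tsum_comm.symm

lemma sT_ofReal (T : ℕ → Prop) (x : ℝ) : sT T (x : ℂ) = ((sT T x : ℝ) : ℂ) := by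
  unfold sT
  rw [Complex.ofReal_tsum]
  congr 1
  ext i
  unfold tt
  split_ifs <;> simp

lemma sT_avoid {K : Type*} [NormedField K] [CompleteSpace K] (i : ℕ) (z : K) (hz : ‖z‖ < 1) :
    sT (fun x => x ≠ i + 1) z = sT (fun _ => True) z - z ^ (i + 1) / (1 + z ^ (i + 1)) := by
  unfold sT
  have h := (tt_summable (fun _ => True) z hz).of_norm
  rw [h.tsum_eq_add_tsum_ite i]
  simp only [tt, if_true]
  rw [add_sub_cancel_left]
  congr 1
  ext k
  by_cases hk : k = i <;> simp [hk]

lemma sT_diff (T : ℕ → Prop) : DifferentiableOn ℂ (sT T : ℂ → ℂ) (Metric.ball 0 1) := by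
  intro z hz
  obtain ⟨r, hr1, hr2⟩ := exists_between (mem_ball_zero_iff.1 hz)
  have hr0 : 0 ≤ r := (norm_nonneg z).trans hr1.le
  have hd : DifferentiableOn ℂ (sT T : ℂ → ℂ) (Metric.ball 0 r) := by
    refine Complex.differentiableOn_tsum_of_summable_norm (u := fun i => r ^ (i + 1) * (1 - r)⁻¹) ?_ ?_
      Metric.isOpen_ball ?_
    · apply Summable.mul_right
      exact (summable_nat_add_iff 1).2 (summable_geometric_of_lt_one hr0 hr2)
    · intro i w hw
      have hw1 : ‖w‖ < 1 := (mem_ball_zero_iff.1 hw).trans hr2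
      have hne : 1 + w ^ (i + 1) ≠ 0 := by
        intro h
        have h' : w ^ (i + 1) = -1 := by linear_combination h
        have := congrArg norm h'
        rw [norm_pow, norm_neg, norm_one] at this
        have h3 : ‖w‖ ^ (i + 1) < 1 := pow_lt_one₀ (norm_nonneg _) hw1 (by omega)
        linarith
      unfold tt
      split_ifs
      · fun_prop (disch := assumption)
      · fun_prop
    · intro i w hw
      exact tt_norm_le T i w (mem_ball_zero_iff.1 hw).le hr2
  exact (hd.differentiableAt (Metric.isOpen_ball.mem_nhds (by simpa using hr1))).differentiableWithinAt

lemma sigma_hasDeriv {ρ : ℝ} (h0 : 0 < ρ) (h1 : ρ < 1) :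
    HasDerivAt sigmaFn (deriv sigmaFn ρ) ρ ∧
    HasDerivAt (sT (fun _ => True) : ℂ → ℂ) ((deriv sigmaFn ρ : ℝ) : ℂ) (ρ : ℂ) := by
  have hd : HasDerivAt (sT (fun _ => True) : ℂ → ℂ) (deriv (sT (fun _ => True) : ℂ → ℂ) ρ) (ρ : ℂ) := by
    apply DifferentiableAt.hasDerivAt
    apply (sT_diff _).differentiableAt (Metric.isOpen_ball.mem_nhds _)
    simp [abs_of_pos h0, h1]
  have hev : sigmaFn =ᶠ[nhds ρ] fun x : ℝ => ((sT (fun _ => True) (x : ℂ)) : ℂ).re := by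
    filter_upwards [Ioo_mem_nhds h0 h1] with x hx
    rw [sigma_eq hx.1.le hx.2, sT_ofReal, Complex.ofReal_re]
  have hr : HasDerivAt sigmaFn (deriv (sT (fun _ => True) : ℂ → ℂ) ρ).re ρ :=
    hd.real_of_complex.congr_of_eventuallyEq hev
  rw [hr.deriv]
  refine ⟨hr, ?_⟩
  have e1 := hr.ofReal_comp
  have e2 := hd.comp_ofReal
  have hev2 : (fun y : ℝ => ((sigmaFn y : ℝ) : ℂ)) =ᶠ[nhds ρ] fun x : ℝ => ((sT (fun _ => True) (x : ℂ)) : ℂ) := by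
    filter_upwards [Ioo_mem_nhds h0 h1] with x hx
    rw [sigma_eq hx.1.le hx.2, sT_ofReal]
  have e3 := e2.congr_of_eventuallyEq hev2
  rw [e1.unique e3]
  exact hd

noncomputable def qq (x : ℝ) : ℝ := x / (1 + x) + x ^ 2 / (1 + x ^ 2)

lemma sigma_sub {x y : ℝ} (hx : 0 ≤ x) (hxy : x ≤ y) (hy : y < 1) :
    qq y - qq x ≤ sigmaFn y - sigmaFn x := by
  have hy0 := hx.trans hxy
  rw [sigma_eq hx (hxy.trans_lt hy), sigma_eq hy0 hy]
  unfold sT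
  have sx := tt_summable' (fun _ => True) hx (hxy.trans_lt hy)
  have sy := tt_summable' (fun _ => True) hy0 hy
  rw [← sx.sum_add_tsum_nat_add 2, ← sy.sum_add_tsum_nat_add 2]
  have sx2 : Summable (fun i => tt (fun _ => True) (i + 2) x) :=
    (summable_nat_add_iff (f := fun i => tt (fun _ => True) i x) 2).2 sx
  have sy2 : Summable (fun i => tt (fun _ => True) (i + 2) y) :=
    (summable_nat_add_iff (f := fun i => tt (fun _ => True) i y) 2).2 sy
  have : ∑' i, tt (fun _ => True) (i + 2) x ≤ ∑' i, tt (fun _ => True) (i + 2) y := by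
    refine Summable.tsum_le_tsum (fun i => ?_) sx2 sy2
    simp only [tt, if_true]
    have h := pow_le_pow_left₀ hx hxy (i + 2 + 1)
    have h1 : 0 ≤ x ^ (i + 2 + 1) := by positivity
    rw [div_le_div_iff₀ (by positivity) (by linarith)]
    nlinarith
  simp only [tt, if_true, Finset.sum_range_succ, Finset.sum_range_zero, qq] at this ⊢
  norm_num at this ⊢
  linarith

lemma sigma_deriv_ge {ρ : ℝ} (h0 : 0 < ρ) (h1 : ρ < 1) : 2 / 3 ≤ deriv sigmaFn ρ := by
  have hq : HasDerivAt qq (1 / (1 + ρ) ^ 2 + 2 * ρ / (1 + ρ ^ 2) ^ 2) ρ := by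
    have a1 : HasDerivAt (fun x : ℝ => x / (1 + x)) ((1 * (1 + ρ) - ρ * 1) / (1 + ρ) ^ 2) ρ :=
      (hasDerivAt_id ρ).div ((hasDerivAt_id ρ).const_add 1) (by positivity)
    have a2 : HasDerivAt (fun x : ℝ => x ^ 2 / (1 + x ^ 2))
        (((2 : ℕ) * ρ ^ (2 - 1) * (1 + ρ ^ 2) - ρ ^ 2 * ((2 : ℕ) * ρ ^ (2 - 1))) / (1 + ρ ^ 2) ^ 2) ρ :=
      (hasDerivAt_pow 2 ρ).div ((hasDerivAt_pow 2 ρ).const_add 1) (by positivity)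
    have a3 : HasDerivAt qq _ ρ := a1.add a2
    convert a3 using 1
    push_cast
    ring
  have hd := (sigma_hasDeriv h0 h1).1
  have hge : 1 / (1 + ρ) ^ 2 + 2 * ρ / (1 + ρ ^ 2) ^ 2 ≤ deriv sigmaFn ρ := by
    have t1 := (hasDerivAt_iff_tendsto_slope.1 hq).mono_left
      (nhdsWithin_mono ρ (show Set.Ioi ρ ⊆ {ρ}ᶜ from fun x hx => ne_of_gt hx))
    have t2 := (hasDerivAt_iff_tendsto_slope.1 hd).mono_left
      (nhdsWithin_mono ρ (show Set.Ioi ρ ⊆ {ρ}ᶜ from fun x hx => ne_of_gt hx))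
    refine le_of_tendsto_of_tendsto t1 t2 ?_
    filter_upwards [Ioo_mem_nhdsGT h1] with x hx
    rw [slope_def_field, slope_def_field]
    have := sigma_sub h0.le hx.1.le hx.2
    have h3 : 0 < x - ρ := by linarith [hx.1]
    gcongr
  refine le_trans ?_ hge
  have b1 : ρ / 2 ≤ 2 * ρ / (1 + ρ ^ 2) ^ 2 := by
    rw [div_le_div_iff₀ (by norm_num) (by positivity)]
    have h2 : ρ ^ 2 ≤ 1 := by nlinarith
    have : (1 + ρ ^ 2) ^ 2 ≤ 4 := by nlinarith
    nlinarith
  have b2 : 2 / 3 - ρ / 2 ≤ 1 / (1 + ρ) ^ 2 := by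
    rw [le_div_iff₀ (by positivity)]
    nlinarith [mul_nonneg h0.le (sq_nonneg (ρ - 3 / 5)), sq_nonneg (ρ - 3 / 5)]
  linarith

lemma sigma_lt {x y : ℝ} (hx : 0 ≤ x) (hxy : x < y) (hy : y < 1) : sigmaFn x < sigmaFn y := by
  have := sigma_sub hx hxy.le hy
  have h2 : qq x < qq y := by
    unfold qq
    have hy0 : 0 < y := by linarith
    have e1 : x / (1 + x) < y / (1 + y) := by
      rw [div_lt_div_iff₀ (by positivity) (by positivity)]
      nlinarith
    have e2 : x ^ 2 / (1 + x ^ 2) ≤ y ^ 2 / (1 + y ^ 2) := by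
      rw [div_le_div_iff₀ (by positivity) (by positivity)]
      nlinarith
    linarith
  linarith

lemma eq_of_re_ge {w : ℂ} {r : ℝ} (h : ‖w‖ ≤ r) (h2 : r ≤ w.re) : w = r := by
  have h3 := Complex.re_le_norm w
  have h4 : w.re = r := le_antisymm (h3.trans h) h2
  have h5 : ‖w‖ = r := le_antisymm h (h2.trans h3)
  have h6 : w.im = 0 := by
    have := Complex.sq_norm w
    rw [Complex.normSq_apply, h5, h4] at this
    nlinarith
  apply Complex.ext <;> simp [h4, h6]

lemma nonvanish {ρ : ℝ} (h0 : 0 < ρ) (h1 : ρ < 1) (hs : sigmaFn ρ = 1) {z : ℂ} (hz : ‖z‖ ≤ ρ)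
    (hS : sT (fun _ => True) z = 1) : z = ρ := by
  set T : ℕ → Prop := fun x => x ≠ 0 + 1 with hT
  have hz1 : ‖z‖ < 1 := hz.trans_lt h1
  have hsr : sT T ρ = 1 - ρ / (1 + ρ) := by
    have := sT_avoid (K := ℝ) 0 ρ (by rwa [Real.norm_of_nonneg h0.le])
    rw [← sigma_eq h0.le h1, hs] at this
    simpa using this
  have hpos : 0 < ρ / (1 + ρ) := by positivity
  have hlt : sT T ρ < 1 := by rw [hsr]; linarith
  have hsum := cT_summable T h0 h1 hlt
  have hle := cT_tsum_le T h0 h1 hlt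
  rw [hsr, sub_sub_cancel, one_div_div] at hle
  have hsumz : Summable (fun n => (cT T n : ℝ) * ‖z‖ ^ n) := by
    refine Summable.of_nonneg_of_le (fun _ => by positivity) (fun n => ?_) hsum
    gcongr
  have hgf := gf_identity T z hz1 hsumz
  have hsz := sT_avoid (K := ℂ) 0 z hz1
  rw [hS] at hsz
  simp only [zero_add, pow_one] at hsz
  have hne : 1 + z ≠ 0 := by
    intro h
    have h' : z = -1 := by linear_combination h
    rw [h'] at hz1
    simp at hz1
  have hsz' : sT T z = 1 - z / (1 + z) := hsz
  rw [hsz', sub_sub_cancel] at hgf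
  have hC : z * ∑' n, (cT T n : ℂ) * z ^ n = 1 + z := by
    field_simp at hgf
    linear_combination hgf
  have hsA : Summable (fun n => (cT T n : ℂ) * z ^ n) := by
    apply Summable.of_norm
    simpa using hsumz
  have hs1 : HasSum (fun n => (cT T n : ℝ) * (z ^ (n + 1)).re) (1 + z.re) := by
    have := (hsA.hasSum.mul_left z)
    rw [hC] at this
    have := Complex.hasSum_re this
    convert this using 1
    · ext n
      have : z * ((cT T n : ℂ) * z ^ n) = ((cT T n : ℝ) : ℂ) * z ^ (n + 1) := by
        push_cast; ring
      rw [this, Complex.re_ofReal_mul]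
    · simp
  have hs2 : HasSum (fun n => (cT T n : ℝ) * ρ ^ (n + 1)) (ρ * ∑' n, (cT T n : ℝ) * ρ ^ n) := by
    have := hsum.hasSum.mul_left ρ
    have hfun : (fun n => (cT T n : ℝ) * ρ ^ (n + 1)) = fun n => ρ * ((cT T n : ℝ) * ρ ^ n) := by
      funext n
      ring
    rw [hfun]
    exact this
  have hs3 := hs2.sub hs1
  have hP : ρ * ∑' n, (cT T n : ℝ) * ρ ^ n ≤ 1 + ρ := by
    calc _ ≤ ρ * ((1 + ρ) / ρ) := by gcongr
      _ = 1 + ρ := by field_simp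
  have hre : ∀ n, (z ^ n).re ≤ ρ ^ n := by
    intro n
    refine (Complex.re_le_norm _).trans ?_
    rw [norm_pow]
    gcongr
  have key : ∀ m, 2 ≤ m → z ^ (m + 1) = (ρ : ℂ) ^ (m + 1) := by
    intro m hm
    have hc : (1 : ℝ) ≤ cT T m := by
      exact_mod_cast cT_pos_single (by omega) (by simp [hT]; omega)
    have h := sum_le_hasSum {0, m} (fun n _ => ?_) hs3
    · rw [Finset.sum_pair (by omega)] at h
      simp only [cT_zero, zero_add, pow_one, Nat.cast_one, one_mul] at h
      have h6 : ρ ^ (m + 1) ≤ (z ^ (m + 1)).re := by nlinarith [hre (m + 1)]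
      have h7 := eq_of_re_ge (w := z ^ (m + 1)) (by rw [norm_pow]; gcongr) h6
      rw [h7]
      push_cast
      rfl
    · rw [← mul_sub]
      exact mul_nonneg (by positivity) (by linarith [hre (n + 1)])
  have k2 := key 2 le_rfl
  have k3 := key 3 (by norm_num)
  norm_num at k2 k3
  have hρ0 : (ρ : ℂ) ^ 3 ≠ 0 := by
    apply pow_ne_zero
    exact_mod_cast h0.ne'
  have : (ρ : ℂ) ^ 3 * (z - ρ) = 0 := by
    linear_combination k3 - z * k2
  rcases mul_eq_zero.1 this with h | h
  · exact absurd h hρ0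
  · linear_combination h

lemma u_tendsto {ρ : ℝ} (h0 : 0 < ρ) (h1 : ρ < 1) (hs : sigmaFn ρ = 1) :
    Tendsto (fun n => (cT (fun _ => True) n : ℝ) * ρ ^ n) atTop (nhds (1 / (ρ * deriv sigmaFn ρ))) := by
  set T : ℕ → Prop := fun _ => True with hT
  set S : ℂ → ℂ := sT T with hSdef
  set d := deriv sigmaFn ρ with hd
  have hdpos : 0 < d := lt_of_lt_of_le (by norm_num) (sigma_deriv_ge h0 h1)
  have hSρ : S ρ = 1 := by
    rw [hSdef, sT_ofReal, ← sigma_eq h0.le h1, hs]; simp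
  have hρball : (ρ : ℂ) ∈ Metric.ball (0 : ℂ) 1 := by simp [abs_of_pos h0, h1]
  have hder := (sigma_hasDeriv h0 h1).2
  set h : ℂ → ℂ := dslope S ρ with hh
  have hhd : DifferentiableOn ℂ h (Metric.ball 0 1) :=
    (Complex.differentiableOn_dslope (Metric.isOpen_ball.mem_nhds hρball)).2 (sT_diff T)
  have hhρ : h ρ = d := by
    rw [hh, dslope_same]
    exact hder.deriv
  have hhz : ∀ z, h z * (z - ρ) = S z - 1 := by
    intro z
    have := sub_smul_dslope S (ρ : ℂ) z
    rw [hSρ, smul_eq_mul] at this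
    rw [← this, mul_comm]
  have hhne : ∀ z ∈ Metric.closedBall (0 : ℂ) ρ, h z ≠ 0 := by
    intro z hz hz0
    have h2 := hhz z
    rw [hz0, zero_mul] at h2
    have : z = ρ := nonvanish h0 h1 hs (by simpa using hz) (by
      rw [← hT]; linear_combination -h2)
    rw [this, hhρ] at hz0
    exact hdpos.ne' (by exact_mod_cast hz0)
  set U := Metric.ball (0 : ℂ) 1 ∩ h ⁻¹' {0}ᶜ with hU
  have hUo : IsOpen U := hhd.continuousOn.isOpen_inter_preimage Metric.isOpen_ball isOpen_compl_singleton
  have hsub : Metric.closedBall (0 : ℂ) ρ ⊆ U := fun z hz =>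
    ⟨Metric.closedBall_subset_ball h1 hz, hhne z hz⟩
  obtain ⟨δ, hδ, hδU⟩ := (isCompact_closedBall (0 : ℂ) ρ).exists_thickening_subset_open hUo hsub
  rw [thickening_closedBall hδ h0.le] at hδU
  set R : NNReal := ⟨ρ + δ / 2, by positivity⟩ with hR
  have hRv : (R : ℝ) = ρ + δ / 2 := rfl
  have hgd : DifferentiableOn ℂ (fun z => (h z)⁻¹) (Metric.closedBall 0 R) := by
    have hs1 : Metric.closedBall (0 : ℂ) R ⊆ U :=
      (Metric.closedBall_subset_ball (by rw [hRv]; linarith)).trans hδU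
    exact (hhd.mono fun z hz => (hs1 hz).1).inv fun z hz => (hs1 hz).2
  have hfp := hgd.hasFPowerSeriesOnBall (by
    rw [← NNReal.coe_pos, hRv]; positivity)
  set p := cauchyPowerSeries (fun z => (h z)⁻¹) 0 R with hp
  set a : ℕ → ℂ := fun n => (cT T n : ℂ) with ha
  set b : ℕ → ℂ := fun n => ρ * a n - (if n = 0 then 0 else a (n - 1)) with hb
  have hp2 : HasFPowerSeriesAt (fun z => (h z)⁻¹) (FormalMultilinearSeries.ofScalars ℂ b) 0 := by
    rw [hasFPowerSeriesAt_iff]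
    have : Metric.ball (0 : ℂ) ρ ∈ nhds (0 : ℂ) := Metric.ball_mem_nhds _ h0
    filter_upwards [this] with z hz
    rw [mem_ball_zero_iff] at hz
    simp only [FormalMultilinearSeries.coeff_ofScalars, zero_add, smul_eq_mul]
    obtain ⟨x, hx1, hx2⟩ := exists_between hz
    have hx0 : 0 < x := (norm_nonneg z).trans_lt hx1
    have hσx : sT T x < 1 := by
      rw [← sigma_eq hx0.le (hx2.trans h1), ← hs]
      exact sigma_lt hx0.le hx2 h1
    have hsumz : Summable (fun n => (cT T n : ℝ) * ‖z‖ ^ n) := by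
      refine Summable.of_nonneg_of_le (fun _ => by positivity) (fun n => ?_)
        (cT_summable T hx0 (hx2.trans h1) hσx)
      gcongr
    have hgf := gf_identity T z (hz.trans h1) hsumz
    have hsA : Summable (fun n => a n * z ^ n) := by
      apply Summable.of_norm
      simpa [ha] using hsumz
    have e1 : HasSum (fun n => (if n = 0 then 0 else a (n - 1)) * z ^ n) (z * ∑' n, a n * z ^ n) := by
      rw [← hasSum_nat_add_iff' 1]
      simp only [Finset.sum_range_one, if_true, zero_mul, sub_zero]
      have hfun : (fun n => (if n + 1 = 0 then 0 else a (n + 1 - 1)) * z ^ (n + 1))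
          = fun n => z * (a n * z ^ n) := by
        funext n
        simp
        ring
      rw [hfun]
      exact hsA.hasSum.mul_left z
    have e2 := (hsA.hasSum.mul_left (ρ : ℂ)).sub e1
    convert e2 using 1
    · ext n
      simp only [hb]
      ring
    · have h3 := hhz z
      have hz0 := hhne z (by simpa using hz.le)
      rw [← sub_mul]
      have : h z * ((ρ - z) * ∑' n, a n * z ^ n) = 1 := by
        have : (∑' n, a n * z ^ n) * (1 - S z) = 1 := hgf
        linear_combination this - (∑' n, a n * z ^ n) * h3
      exact (eq_inv_of_mul_eq_one_right this).symm
  have hpe := hfp.hasFPowerSeriesAt.eq_formalMultilinearSeries hp2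
  have hsumρ : HasSum (fun n => (ρ : ℂ) ^ n * b n) ((d : ℂ)⁻¹) := by
    have hm : (ρ : ℂ) ∈ Metric.eball (0 : ℂ) R := by
      rw [Metric.eball_coe, mem_ball_zero_iff, hRv]
      simp [abs_of_pos h0]
      linarith
    have := hfp.hasSum hm
    rw [hpe] at this
    simpa [FormalMultilinearSeries.coeff_ofScalars, hhρ] using this
  have ht := hsumρ.tendsto_sum_nat
  have hpart : ∀ N, ∑ n ∈ Finset.range (N + 1), (ρ : ℂ) ^ n * b n = ρ * (a N * ρ ^ N) := by
    intro N
    induction N with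
    | zero => simp [hb]
    | succ N ih =>
      rw [Finset.sum_range_succ, ih]
      simp [hb]
      ring
  have ht2 := (ht.comp (tendsto_add_atTop_nat 1)).const_mul ((ρ : ℂ)⁻¹)
  have hρC : (ρ : ℂ) ≠ 0 := by exact_mod_cast h0.ne'
  have ht3 : Tendsto (fun n => (((cT T n : ℝ) * ρ ^ n : ℝ) : ℂ)) atTop
      (nhds ((1 / (ρ * d) : ℝ) : ℂ)) := by
    convert ht2 using 1
    · ext n
      simp only [Function.comp, hpart]
      rw [inv_mul_cancel_left₀ hρC]
      push_cast
      rfl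
    · congr 1
      push_cast
      rw [one_div, mul_inv]
  exact (Complex.continuous_re.tendsto _).comp ht3

noncomputable def ee (i k : ℕ) : ℝ :=
  if i + 1 ∣ k ∧ k ≠ 0 then (-1) ^ (k / (i + 1) + 1) else 0

lemma ee_abs_le (i k : ℕ) : |ee i k| ≤ 1 := by
  unfold ee
  split_ifs <;> simp

lemma ee_zero_of_le {i k : ℕ} (h : k ≤ i) : ee i k = 0 := by
  unfold ee
  rw [if_neg]
  rintro ⟨h1, h2⟩
  have := Nat.le_of_dvd (Nat.pos_of_ne_zero h2) h1
  omega

lemma ee_self (i : ℕ) : ee i (i + 1) = 1 := by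
  unfold ee
  rw [if_pos ⟨dvd_rfl, by omega⟩, Nat.div_self (by omega)]
  norm_num

lemma ee_zero_of_lt {i k : ℕ} (h : k < 2 * (i + 1)) (h2 : k ≠ i + 1) : ee i k = 0 := by
  unfold ee
  rw [if_neg]
  rintro ⟨⟨m, rfl⟩, h4⟩
  have : m < 2 := by
    by_contra hm
    push Not at hm
    nlinarith
  interval_cases m <;> simp at *

noncomputable def EE (i : ℕ) : PowerSeries ℝ := PowerSeries.mk (ee i)

lemma EE_mul (i : ℕ) : EE i * (1 + PowerSeries.X ^ (i + 1)) = PowerSeries.X ^ (i + 1) := by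
  ext k
  rw [mul_add, mul_one, map_add, PowerSeries.coeff_mul_X_pow', PowerSeries.coeff_X_pow]
  simp only [EE, PowerSeries.coeff_mk]
  rcases lt_or_ge k (i + 1) with h | h
  · rw [if_neg (by omega), if_neg (by omega), ee_zero_of_le (by omega), add_zero]
  · obtain ⟨m, rfl⟩ := Nat.exists_eq_add_of_le h
    rw [if_pos h, Nat.add_sub_cancel_left]
    rcases Nat.eq_zero_or_pos m with rfl | hm
    · simp only [add_zero, ee_self, if_true]
      rw [ee_zero_of_le (by omega), add_zero]
    · rw [if_neg (by omega)]
      unfold ee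
      by_cases hd : i + 1 ∣ m
      · rw [if_pos ⟨(Nat.dvd_add_right dvd_rfl).2 hd, by omega⟩, if_pos ⟨hd, by omega⟩,
          Nat.add_div_left _ (by omega), pow_succ _ (m / (i + 1) + 1)]
        ring
      · rw [if_neg (fun h' => hd ((Nat.dvd_add_right dvd_rfl).1 h'.1)), if_neg (fun h' => hd h'.1), add_zero]

noncomputable def PA (T : ℕ → Prop) : PowerSeries ℝ := PowerSeries.mk fun n => (cT T n : ℝ)
noncomputable def PF (T : ℕ → Prop) (i : ℕ) : PowerSeries ℝ := PowerSeries.mk fun n => (fT T (i + 1) n : ℝ)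

open Classical in
lemma PF_eq (T : ℕ → Prop) (i : ℕ) : PF T i = (if T (i + 1) then EE i else 0) * PA T := by
  by_cases hT : T (i + 1)
  swap
  · rw [if_neg hT, zero_mul]
    ext n
    simp [PF, fT_zero_of_not hT]
  rw [if_pos hT]
  have h1 : PF T i * (1 + PowerSeries.X ^ (i + 1)) = PA T * PowerSeries.X ^ (i + 1) := by
    ext k
    rw [mul_add, mul_one, map_add, PowerSeries.coeff_mul_X_pow', PowerSeries.coeff_mul_X_pow']
    simp only [PF, PA, PowerSeries.coeff_mk]
    rcases lt_or_ge k (i + 1) with h | h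
    · rw [if_neg (by omega), if_neg (by omega), fT_zero_of_lt h]
      simp
    · obtain ⟨m, rfl⟩ := Nat.exists_eq_add_of_le h
      rw [if_pos h, if_pos h, Nat.add_sub_cancel_left, add_comm (i + 1) m,
        ← fT_rec (T := T) (Nat.succ_pos i) hT m]
      push_cast
      rfl
  have hne : (1 + PowerSeries.X ^ (i + 1) : PowerSeries ℝ) ≠ 0 := by
    intro h
    have := congrArg (PowerSeries.coeff 0) h
    simp at this
  apply mul_right_cancel₀ hne
  rw [h1]
  linear_combination (-PA T) * EE_mul i

open Classical in
noncomputable def ss (T : ℕ → Prop) (k : ℕ) : ℝ :=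
  ∑ i ∈ Finset.range k, if T (i + 1) then ee i k else 0

noncomputable def SS (T : ℕ → Prop) : PowerSeries ℝ := PowerSeries.mk (ss T)

lemma ss_abs_le (T : ℕ → Prop) (k : ℕ) : |ss T k| ≤ k := by
  unfold ss
  refine (Finset.abs_sum_le_sum_abs _ _).trans ?_
  calc _ ≤ ∑ i ∈ Finset.range k, (1 : ℝ) := by
        apply Finset.sum_le_sum
        intro i _
        split_ifs
        · exact ee_abs_le i k
        · simp
    _ = k := by simp

lemma PA_eq (T : ℕ → Prop) : PA T = 1 + SS T * PA T := by
  classical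
  ext n
  have hext : ∀ k, k ≤ n → ss T k = ∑ i ∈ Finset.range n, if T (i + 1) then ee i k else 0 := by
    intro k hk
    unfold ss
    apply Finset.sum_subset
    · simpa using hk
    · intro i _ hi
      rw [ee_zero_of_le (by simpa using hi)]
      simp
  have h1 : PowerSeries.coeff n (SS T * PA T) = ∑ i ∈ Finset.range n, (fT T (i + 1) n : ℝ) := by
    calc PowerSeries.coeff n (SS T * PA T)
        = ∑ x ∈ Finset.HasAntidiagonal.antidiagonal n, ss T x.1 * cT T x.2 := by
          rw [PowerSeries.coeff_mul]
          simp [SS, PA]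
      _ = ∑ x ∈ Finset.HasAntidiagonal.antidiagonal n, ∑ i ∈ Finset.range n,
            (if T (i + 1) then ee i x.1 else 0) * cT T x.2 := by
          apply Finset.sum_congr rfl
          intro x hx
          rw [hext x.1 (by have := Finset.HasAntidiagonal.mem_antidiagonal.1 hx; omega), Finset.sum_mul]
      _ = ∑ i ∈ Finset.range n, ∑ x ∈ Finset.HasAntidiagonal.antidiagonal n,
            (if T (i + 1) then ee i x.1 else 0) * cT T x.2 := Finset.sum_comm
      _ = ∑ i ∈ Finset.range n, PowerSeries.coeff n (PF T i) := by
          apply Finset.sum_congr rfl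
          intro i _
          rw [PF_eq, PowerSeries.coeff_mul]
          apply Finset.sum_congr rfl
          intro x _
          split_ifs <;> simp [EE, PA]
      _ = _ := by simp [PF]
  rw [map_add, h1, PowerSeries.coeff_one]
  simp only [PA, PowerSeries.coeff_mk]
  rw [cT_eq_sum]
  push_cast
  rfl

lemma SS_avoid (i : ℕ) : SS (fun _ => True) = SS (fun x => x ≠ i + 1) + EE i := by
  classical
  ext k
  simp only [SS, EE, map_add, PowerSeries.coeff_mk, ss, if_true]
  have h : ∀ l ∈ Finset.range k, ee l k = (if l + 1 ≠ i + 1 then ee l k else 0)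
      + (if l = i then ee i k else 0) := by
    intro l _
    by_cases hl : l = i <;> simp [hl]
  rw [Finset.sum_congr rfl h, Finset.sum_add_distrib, Finset.sum_ite_eq']
  congr 1
  · apply Finset.sum_congr rfl
    intro l _
    congr
  · split_ifs with hi
    · rfl
    · rw [ee_zero_of_le (by simpa using hi)]

lemma PA_avoid (i : ℕ) : PA (fun _ => True) =
    PA (fun x => x ≠ i + 1) + PA (fun x => x ≠ i + 1) * (PA (fun _ => True) * EE i) := by
  have h1 := PA_eq (fun _ => True)
  have h2 := PA_eq (fun x => x ≠ i + 1)
  rw [SS_avoid i] at h1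
  linear_combination PA (fun x => x ≠ i + 1) * h1 - PA (fun _ => True) * h2

lemma PA_deriv (T : ℕ → Prop) : PowerSeries.derivative ℝ (PA T) =
    PA T * (PA T * PowerSeries.derivative ℝ (SS T)) := by
  have h1 := PA_eq T
  have h2 := congrArg (PowerSeries.derivative ℝ) h1
  rw [map_add, Derivation.leibniz, PowerSeries.derivative_one, zero_add, smul_eq_mul, smul_eq_mul] at h2
  linear_combination (PA T) * h2 - (PowerSeries.derivative ℝ (PA T)) * h1

lemma conv_scale (P Q : PowerSeries ℝ) (ρ : ℝ) (n : ℕ) :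
    PowerSeries.coeff n (P * Q) * ρ ^ n = ∑ m ∈ Finset.range (n + 1),
      (PowerSeries.coeff m P * ρ ^ m) * (PowerSeries.coeff (n - m) Q * ρ ^ (n - m)) := by
  rw [PowerSeries.coeff_mul, Finset.Nat.sum_antidiagonal_eq_sum_range_succ_mk, Finset.sum_mul]
  apply Finset.sum_congr rfl
  intro m hm
  have : n = m + (n - m) := by have := Finset.mem_range.1 hm; omega
  conv_lhs => rw [this, pow_add]
  simp only [Nat.add_sub_cancel_left]
  ring

noncomputable def uu (ρ : ℝ) (n : ℕ) : ℝ := (cT (fun _ => True) n : ℝ) * ρ ^ n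
noncomputable def vv (ρ : ℝ) (i n : ℕ) : ℝ := (cT (fun x => x ≠ i + 1) n : ℝ) * ρ ^ n
noncomputable def qk (ρ : ℝ) (i r : ℕ) : ℝ :=
  ∑ k ∈ Finset.range (r + 1), uu ρ k * (ee i (r - k) * ρ ^ (r - k))

lemma uu_nonneg {ρ : ℝ} (h0 : 0 < ρ) (n : ℕ) : 0 ≤ uu ρ n := by unfold uu; positivity
lemma vv_nonneg {ρ : ℝ} (h0 : 0 < ρ) (i n : ℕ) : 0 ≤ vv ρ i n := by unfold vv; positivity
lemma vv_le_uu {ρ : ℝ} (h0 : 0 < ρ) (i n : ℕ) : vv ρ i n ≤ uu ρ n := by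
  unfold vv uu
  gcongr
  exact cT_mono (fun _ _ => trivial) n

lemma uv_identity (ρ : ℝ) (i n : ℕ) :
    uu ρ n = vv ρ i n + ∑ m ∈ Finset.range (n + 1), vv ρ i m * qk ρ i (n - m) := by
  have h := congrArg (fun P => PowerSeries.coeff n P * ρ ^ n) (PA_avoid i)
  simp only [map_add, add_mul] at h
  rw [conv_scale] at h
  simp only [conv_scale] at h
  simpa [PA, EE, uu, vv, qk] using h

lemma geom_tail_le {ρ : ℝ} (h0 : 0 < ρ) (h1 : ρ < 1) (J : ℕ) (s : Finset ℕ) (hs : ∀ k ∈ s, J ≤ k) :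
    ∑ k ∈ s, ρ ^ k ≤ ρ ^ J * (1 - ρ)⁻¹ := by
  have hsum := summable_geometric_of_lt_one h0.le h1
  calc ∑ k ∈ s, ρ ^ k = ∑ k ∈ s, ρ ^ J * ρ ^ (k - J) := by
        apply Finset.sum_congr rfl
        intro k hk
        rw [← pow_add]
        congr 1
        have := hs k hk
        omega
    _ = ρ ^ J * ∑ k ∈ s, ρ ^ (k - J) := by rw [Finset.mul_sum]
    _ = ρ ^ J * ∑ k ∈ s.image (fun k => k - J), ρ ^ k := by
        rw [Finset.sum_image]
        intro a ha b hb hab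
        have := hs a ha
        have := hs b hb
        simp only at hab
        omega
    _ ≤ _ := by
        rw [← tsum_geometric_of_lt_one h0.le h1]
        gcongr
        exact hsum.sum_le_tsum _ (fun _ _ => by positivity)

/-- upper tail bound -/
lemma upper_bound {ρ C : ℝ} (h0 : 0 < ρ) (h1 : ρ < 1) (hC : ∀ n, uu ρ n ≤ C) (i n : ℕ) :
    uu ρ n - vv ρ i n ≤ (n + 1) * (C * (C * (ρ ^ (i + 1) * (1 - ρ)⁻¹))) := by
  have hC0 : 0 ≤ C := (uu_nonneg h0 0).trans (hC 0)
  have hq : ∀ r, |qk ρ i r| ≤ C * (ρ ^ (i + 1) * (1 - ρ)⁻¹) := by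
    intro r
    unfold qk
    rw [← Finset.sum_range_reflect]
    refine (Finset.abs_sum_le_sum_abs _ _).trans ?_
    calc _ ≤ ∑ k ∈ Finset.range (r + 1), C * (if i + 1 ≤ k then ρ ^ k else 0) := by
          apply Finset.sum_le_sum
          intro k hk
          have hk' := Finset.mem_range.1 hk
          have e1 : r - (r + 1 - 1 - k) = k := by omega
          rw [e1, abs_mul, abs_mul, abs_of_nonneg (uu_nonneg h0 _), abs_of_pos (pow_pos h0 k)]
          apply mul_le_mul (hC _) _ (by positivity) hC0
          split_ifs with hik
          · exact mul_le_of_le_one_left (by positivity) (ee_abs_le i k)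
          · rw [ee_zero_of_le (by omega)]; simp
      _ = C * ∑ k ∈ (Finset.range (r + 1)).filter (fun k => i + 1 ≤ k), ρ ^ k := by
          rw [← Finset.mul_sum, Finset.sum_filter]
      _ ≤ _ := by
          gcongr
          exact geom_tail_le h0 h1 _ _ (fun k hk => (Finset.mem_filter.1 hk).2)
  rw [uv_identity ρ i n, add_sub_cancel_left]
  calc _ ≤ ∑ m ∈ Finset.range (n + 1), C * (C * (ρ ^ (i + 1) * (1 - ρ)⁻¹)) := by
        apply Finset.sum_le_sum
        intro m _
        calc vv ρ i m * qk ρ i (n - m) ≤ vv ρ i m * |qk ρ i (n - m)| := by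
              gcongr
              · exact vv_nonneg h0 _ _
              · exact le_abs_self _
          _ ≤ _ := by
              apply mul_le_mul ((vv_le_uu h0 i m).trans (hC m)) (hq _) (abs_nonneg _) hC0
    _ = _ := by simp

/-- lower range bound -/
lemma lower_bound {ρ C : ℝ} (h0 : 0 < ρ) (h1 : ρ < 1) (hs : sigmaFn ρ = 1) (hC : ∀ n, uu ρ n ≤ C) :
    ∃ W : ℝ, 0 ≤ W ∧ ∀ i n : ℕ, n * vv ρ i n * ρ ^ (i + 1) ≤ W := by
  have hC0 : 0 ≤ C := (uu_nonneg h0 0).trans (hC 0)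
  have hsumW : Summable (fun k : ℕ => ((k : ℝ) + 1) ^ 2 * ρ ^ k) := by
    have e0 := summable_pow_mul_geometric_of_norm_lt_one (R := ℝ) 2 (r := ρ) (by rwa [Real.norm_of_nonneg h0.le])
    have := ((summable_nat_add_iff (f := fun n : ℕ => (n : ℝ) ^ 2 * ρ ^ n) 1).2 e0).mul_left ρ⁻¹
    have hfun : (fun k : ℕ => ((k : ℝ) + 1) ^ 2 * ρ ^ k)
        = fun k : ℕ => ρ⁻¹ * (((k + 1 : ℕ) : ℝ) ^ 2 * ρ ^ (k + 1)) := by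
      funext k
      push_cast
      field_simp
      ring
    rw [hfun]
    exact this
  set W := ∑' k : ℕ, ((k : ℝ) + 1) ^ 2 * ρ ^ k with hW
  have hW0 : 0 ≤ W := tsum_nonneg fun _ => by positivity
  refine ⟨C * W * 2, by positivity, fun i n => ?_⟩
  have hsr : sT (fun x => x ≠ i + 1) ρ = 1 - ρ ^ (i + 1) / (1 + ρ ^ (i + 1)) := by
    have := sT_avoid (K := ℝ) i ρ (by rwa [Real.norm_of_nonneg h0.le])
    rwa [← sigma_eq h0.le h1, hs] at this
  have hpos : 0 < ρ ^ (i + 1) / (1 + ρ ^ (i + 1)) := by positivity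
  have hlt : sT (fun x => x ≠ i + 1) ρ < 1 := by rw [hsr]; linarith
  have hle := cT_bound (fun x => x ≠ i + 1) h0 h1 hlt
  rw [hsr, sub_sub_cancel, one_div_div] at hle
  rcases n with _ | n
  · simp; positivity
  set A := PA (fun x => x ≠ i + 1) with hA
  set D := PowerSeries.derivative ℝ (SS (fun x => x ≠ i + 1)) with hD
  have hG : ∀ r, |PowerSeries.coeff r (A * D) * ρ ^ r| ≤ C * W := by
    intro r
    rw [conv_scale, ← Finset.sum_range_reflect]
    refine (Finset.abs_sum_le_sum_abs _ _).trans ?_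
    calc _ ≤ ∑ k ∈ Finset.range (r + 1), C * (((k : ℝ) + 1) ^ 2 * ρ ^ k) := by
          apply Finset.sum_le_sum
          intro k hk
          have hk' := Finset.mem_range.1 hk
          have e1 : r - (r + 1 - 1 - k) = k := by omega
          rw [e1, abs_mul]
          apply mul_le_mul _ _ (abs_nonneg _) hC0
          · have e2 : PowerSeries.coeff (r + 1 - 1 - k) A * ρ ^ (r + 1 - 1 - k) = vv ρ i (r + 1 - 1 - k) := by
              simp [hA, PA, vv]
            rw [e2, abs_of_nonneg (vv_nonneg h0 _ _)]
            exact (vv_le_uu h0 _ _).trans (hC _)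
          · rw [abs_mul, abs_of_pos (pow_pos h0 k), hD, PowerSeries.coeff_derivative, abs_mul]
            gcongr
            rw [pow_two]
            have := ss_abs_le (fun x => x ≠ i + 1) (k + 1)
            push_cast at this
            apply mul_le_mul
            · simpa [SS] using this
            · rw [abs_of_nonneg (by positivity)]
            · positivity
            · positivity
      _ = C * ∑ k ∈ Finset.range (r + 1), (((k : ℝ) + 1) ^ 2 * ρ ^ k) := by rw [Finset.mul_sum]
      _ ≤ _ := by
          gcongr
          exact hsumW.sum_le_tsum _ (fun _ _ => by positivity)
  have hmain : ((n + 1 : ℕ) : ℝ) * vv ρ i (n + 1) = ρ * (PowerSeries.coeff n (A * (A * D)) * ρ ^ n) := by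
    rw [hD, hA, ← PA_deriv, PowerSeries.coeff_derivative]
    simp only [PA, PowerSeries.coeff_mk, vv]
    push_cast
    ring
  have hconv : PowerSeries.coeff n (A * (A * D)) * ρ ^ n ≤ (C * W) * ((1 + ρ ^ (i + 1)) / ρ ^ (i + 1)) := by
    rw [conv_scale]
    calc _ ≤ ∑ m ∈ Finset.range (n + 1), (C * W) * vv ρ i m := by
          apply Finset.sum_le_sum
          intro m _
          have e2 : PowerSeries.coeff m A * ρ ^ m = vv ρ i m := by
            simp [hA, PA, vv]
          rw [e2, mul_comm]
          exact mul_le_mul_of_nonneg_right ((le_abs_self _).trans (hG _)) (vv_nonneg h0 _ _)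
      _ = (C * W) * ∑ m ∈ Finset.range (n + 1), vv ρ i m := by rw [Finset.mul_sum]
      _ ≤ _ := by
          gcongr
          exact hle (n + 1)
  have hp1 : ρ ^ (i + 1) ≤ 1 := pow_le_one₀ h0.le h1.le
  have hpp : 0 < ρ ^ (i + 1) := pow_pos h0 _
  have hfin : ((n + 1 : ℕ) : ℝ) * vv ρ i (n + 1) ≤ (C * W) * ((1 + ρ ^ (i + 1)) / ρ ^ (i + 1)) := by
    rw [hmain]
    calc _ ≤ ρ * ((C * W) * ((1 + ρ ^ (i + 1)) / ρ ^ (i + 1))) := by gcongr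
      _ ≤ _ := mul_le_of_le_one_left (by positivity) h1.le
  calc _ ≤ (C * W) * ((1 + ρ ^ (i + 1)) / ρ ^ (i + 1)) * ρ ^ (i + 1) := by gcongr
    _ = (C * W) * (1 + ρ ^ (i + 1)) := by field_simp
    _ ≤ _ := by
      gcongr
      linarith

lemma qk_zero (ρ : ℝ) (i : ℕ) : qk ρ i 0 = 0 := by
  simp [qk, ee_zero_of_le]

lemma qk_close {ρ C c : ℝ} (h0 : 0 < ρ) (h1 : ρ < 1) (hC : ∀ n, uu ρ n ≤ C) (hc : 0 ≤ c) (i r : ℕ) :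
    |qk ρ i r - c * ρ ^ (i + 1)| ≤
      ρ ^ (i + 1) * (if i + 1 ≤ r then |uu ρ (r - (i + 1)) - c| else c)
        + C * (ρ ^ (2 * (i + 1)) * (1 - ρ)⁻¹) := by
  have hC0 : 0 ≤ C := (uu_nonneg h0 0).trans (hC 0)
  have hr : qk ρ i r = ∑ k ∈ Finset.range (r + 1), uu ρ (r - k) * (ee i k * ρ ^ k) := by
    unfold qk
    rw [← Finset.sum_range_reflect]
    apply Finset.sum_congr rfl
    intro k hk
    have hk' := Finset.mem_range.1 hk
    have e1 : r - (r + 1 - 1 - k) = k := by omega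
    have e2 : r + 1 - 1 - k = r - k := by omega
    rw [e1, e2]
  have hsplit : qk ρ i r = (∑ k ∈ Finset.range (r + 1), if k = i + 1 then uu ρ (r - k) * ρ ^ k else 0)
      + ∑ k ∈ Finset.range (r + 1), if 2 * (i + 1) ≤ k then uu ρ (r - k) * (ee i k * ρ ^ k) else 0 := by
    rw [hr, ← Finset.sum_add_distrib]
    apply Finset.sum_congr rfl
    intro k _
    by_cases hk : k = i + 1
    · rw [if_pos hk, if_neg (by omega), hk, ee_self]; ring
    · rw [if_neg hk]
      split_ifs with h2
      · ring
      · rw [ee_zero_of_lt (by omega) hk]; ring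
  have hA : (∑ k ∈ Finset.range (r + 1), if k = i + 1 then uu ρ (r - k) * ρ ^ k else 0)
      = if i + 1 ≤ r then uu ρ (r - (i + 1)) * ρ ^ (i + 1) else 0 := by
    rw [Finset.sum_ite_eq']
    simp only [Finset.mem_range]
    congr 1
    simp [Nat.lt_succ_iff]
  have hB : |∑ k ∈ Finset.range (r + 1), if 2 * (i + 1) ≤ k then uu ρ (r - k) * (ee i k * ρ ^ k) else 0|
      ≤ C * (ρ ^ (2 * (i + 1)) * (1 - ρ)⁻¹) := by
    refine (Finset.abs_sum_le_sum_abs _ _).trans ?_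
    calc _ ≤ ∑ k ∈ Finset.range (r + 1), C * (if 2 * (i + 1) ≤ k then ρ ^ k else 0) := by
          apply Finset.sum_le_sum
          intro k hk
          split_ifs with hik
          · rw [abs_mul, abs_mul, abs_of_nonneg (uu_nonneg h0 _), abs_of_pos (pow_pos h0 k)]
            apply mul_le_mul (hC _) _ (by positivity) hC0
            exact mul_le_of_le_one_left (by positivity) (ee_abs_le i k)
          · simp
      _ = C * ∑ k ∈ (Finset.range (r + 1)).filter (fun k => 2 * (i + 1) ≤ k), ρ ^ k := by
          rw [← Finset.mul_sum, Finset.sum_filter]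
      _ ≤ _ := by
          gcongr
          exact geom_tail_le h0 h1 _ _ (fun k hk => (Finset.mem_filter.1 hk).2)
  rw [hsplit, hA, add_sub_right_comm]
  refine (abs_add_le _ _).trans (add_le_add ?_ hB)
  have hp : 0 < ρ ^ (i + 1) := pow_pos h0 _
  split_ifs with h
  · rw [← sub_mul, abs_mul, abs_of_pos hp, mul_comm]
  · rw [zero_sub, abs_neg, abs_of_nonneg (by positivity), mul_comm]

/-- error accumulation -/
noncomputable def DD (ρ c : ℝ) (n : ℕ) : ℝ := ∑ m ∈ Finset.range n, |uu ρ m - c|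

lemma DD_mono (ρ c : ℝ) : Monotone (DD ρ c) := by
  apply monotone_nat_of_le_succ
  intro n
  unfold DD
  rw [Finset.sum_range_succ]
  linarith [abs_nonneg (uu ρ n - c)]

lemma DD_nonneg (ρ c : ℝ) (n : ℕ) : 0 ≤ DD ρ c n := Finset.sum_nonneg fun _ _ => abs_nonneg _

lemma qk_sum {ρ C c : ℝ} (h0 : 0 < ρ) (h1 : ρ < 1) (hC : ∀ n, uu ρ n ≤ C) (hc : 0 ≤ c) (i n : ℕ) :
    ∑ m ∈ Finset.range n, |qk ρ i (n - m) - c * ρ ^ (i + 1)| ≤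
      ρ ^ (i + 1) * ((i + 1 : ℕ) * c + DD ρ c n) + n * (C * (ρ ^ (2 * (i + 1)) * (1 - ρ)⁻¹)) := by
  calc _ ≤ ∑ m ∈ Finset.range n, (ρ ^ (i + 1) * (if i + 1 ≤ n - m then |uu ρ (n - m - (i + 1)) - c| else c)
        + C * (ρ ^ (2 * (i + 1)) * (1 - ρ)⁻¹)) :=
        Finset.sum_le_sum fun m _ => qk_close h0 h1 hC hc i (n - m)
    _ = ρ ^ (i + 1) * ∑ m ∈ Finset.range n, (if i + 1 ≤ n - m then |uu ρ (n - m - (i + 1)) - c| else c)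
        + n * (C * (ρ ^ (2 * (i + 1)) * (1 - ρ)⁻¹)) := by
        rw [Finset.sum_add_distrib, ← Finset.mul_sum]; simp
    _ ≤ _ := by
        gcongr
        rw [Finset.sum_ite, add_comm]
        apply add_le_add
        · rw [Finset.sum_const, nsmul_eq_mul]
          gcongr
          calc _ ≤ (Finset.Ico (n - (i+1)) n).card := by
                apply Finset.card_le_card
                intro m hm
                simp only [Finset.mem_filter, Finset.mem_range, Finset.mem_Ico] at hm ⊢
                omega
            _ ≤ _ := by rw [Nat.card_Ico]; omega
        · unfold DD
          rw [← Finset.sum_image (s := (Finset.range n).filter (fun m => i + 1 ≤ n - m))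
            (g := fun m => n - m - (i + 1)) (f := fun k => |uu ρ k - c|)]
          · apply Finset.sum_le_sum_of_subset_of_nonneg
            · intro k hk
              simp only [Finset.mem_image, Finset.mem_filter, Finset.mem_range] at hk ⊢
              omega
            · intros; positivity
          · intro a ha b hb hab
            simp only [Finset.coe_filter, Set.mem_ofPred_eq, Finset.mem_range] at ha hb hab
            omega

/-- model solution -/
lemma model_rec (c y : ℝ) (n : ℕ) : c * (1 - y) ^ n = c - y * ∑ m ∈ Finset.range n, c * (1 - y) ^ m := by
  induction n with
  | zero => simp
  | succ n ih =>
    rw [Finset.sum_range_succ, mul_add, ← sub_sub, ← ih]; ring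

lemma mid_bound {ρ C c : ℝ} (h0 : 0 < ρ) (h1 : ρ < 1) (hC : ∀ n, uu ρ n ≤ C) (hc : 0 ≤ c) (i N : ℕ) (H : ℝ)
    (hH : C * (ρ ^ (i + 1) * ((i + 1 : ℕ) * c + DD ρ c N) + N * (C * (ρ ^ (2 * (i + 1)) * (1 - ρ)⁻¹))) ≤ H) :
    |vv ρ i N - c * (1 - c * ρ ^ (i + 1)) ^ N| ≤
      |uu ρ N - c| + H + c * ρ ^ (i + 1) * ((1 + c * ρ ^ (i + 1)) ^ N * (DD ρ c N + N * H)) := by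
  have hC0 : 0 ≤ C := (uu_nonneg h0 0).trans (hC 0)
  have h1' : 0 < 1 - ρ := by linarith
  set y := c * ρ ^ (i + 1) with hy
  have hy0 : 0 ≤ y := by positivity
  set d : ℕ → ℝ := fun n => vv ρ i n - c * (1 - y) ^ n with hd
  have hH0 : 0 ≤ H := le_trans (by have := DD_nonneg ρ c N; positivity) hH
  have hrec : ∀ n, n ≤ N → |d n| ≤ |uu ρ n - c| + H + y * ∑ m ∈ Finset.range n, |d m| := by
    intro n hn
    have e1 : d n = (uu ρ n - c) - ∑ m ∈ Finset.range n, vv ρ i m * (qk ρ i (n - m) - y)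
        - y * ∑ m ∈ Finset.range n, d m := by
      have h := uv_identity ρ i n
      rw [Finset.sum_range_succ, Nat.sub_self, qk_zero, mul_zero, add_zero] at h
      have h2 := model_rec c y n
      simp only [hd, Finset.sum_sub_distrib, mul_sub]
      rw [h, h2, ← Finset.sum_mul]
      ring
    have e2 : |∑ m ∈ Finset.range n, vv ρ i m * (qk ρ i (n - m) - y)| ≤ H := by
      refine (Finset.abs_sum_le_sum_abs _ _).trans ?_
      calc _ ≤ ∑ m ∈ Finset.range n, C * |qk ρ i (n - m) - y| := by
            apply Finset.sum_le_sum
            intro m _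
            rw [abs_mul, abs_of_nonneg (vv_nonneg h0 _ _)]
            gcongr
            exact (vv_le_uu h0 i m).trans (hC m)
        _ = C * ∑ m ∈ Finset.range n, |qk ρ i (n - m) - y| := by rw [Finset.mul_sum]
        _ ≤ C * (ρ ^ (i + 1) * ((i + 1 : ℕ) * c + DD ρ c n) + n * (C * (ρ ^ (2 * (i + 1)) * (1 - ρ)⁻¹))) := by
            gcongr
            exact qk_sum h0 h1 hC hc i n
        _ ≤ _ := by
            refine le_trans ?_ hH
            have := DD_mono ρ c hn
            gcongr
    have e3 : |y * ∑ m ∈ Finset.range n, d m| ≤ y * ∑ m ∈ Finset.range n, |d m| := by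
      rw [abs_mul, abs_of_nonneg hy0]
      gcongr
      exact Finset.abs_sum_le_sum_abs _ _
    rw [e1]
    refine (abs_sub _ _).trans ?_
    refine add_le_add ((abs_sub _ _).trans ?_) e3
    gcongr
  have hS : ∀ n, n ≤ N → ∑ m ∈ Finset.range n, |d m| ≤ (1 + y) ^ n * (DD ρ c n + n * H) := by
    intro n
    induction n with
    | zero => intro _; simp [DD]
    | succ n ih =>
      intro hn
      have i1 := ih (by omega)
      have i2 := hrec n (by omega)
      rw [Finset.sum_range_succ]
      have e4 : DD ρ c (n + 1) = DD ρ c n + |uu ρ n - c| := by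
        unfold DD; rw [Finset.sum_range_succ]
      rw [e4]
      push_cast
      have hp : 1 ≤ (1 + y) ^ (n + 1) := one_le_pow₀ (by linarith)
      calc _ ≤ (1 + y) * (∑ m ∈ Finset.range n, |d m|) + (|uu ρ n - c| + H) := by linarith
        _ ≤ (1 + y) * ((1 + y) ^ n * (DD ρ c n + n * H)) + (1 + y) ^ (n + 1) * (|uu ρ n - c| + H) := by
          gcongr
          exact le_mul_of_one_le_left (by positivity) hp
        _ = _ := by ring
  refine (hrec N le_rfl).trans ?_
  gcongr
  exact hS N le_rfl

lemma DD_div {ρ c : ℝ} (hu : Tendsto (uu ρ) atTop (nhds c)) :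
    Tendsto (fun n : ℕ => DD ρ c n / n) atTop (nhds 0) := by
  have h : Tendsto (fun n => |uu ρ n - c|) atTop (nhds 0) := by
    have := (hu.sub_const c).abs
    simpa using this
  have h2 := h.cesaro
  have hfun : (fun n : ℕ => DD ρ c n / n) = fun n : ℕ => (n : ℝ)⁻¹ * ∑ i ∈ Finset.range n, |uu ρ i - c| := by
    funext n
    unfold DD
    rw [div_eq_inv_mul]
  rw [hfun]
  exact h2

lemma mid {ρ C c : ℝ} (h0 : 0 < ρ) (h1 : ρ < 1) (hC : ∀ n, uu ρ n ≤ C) (hc : 0 ≤ c)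
    (hu : Tendsto (uu ρ) atTop (nhds c)) (Λ : ℝ) (hΛ : 0 ≤ Λ) :
    ∃ F : ℕ → ℝ, Tendsto F atTop (nhds 0) ∧ ∀ N : ℕ, 1 ≤ N → ∀ i, N * ρ ^ (i + 1) ≤ Λ →
      |vv ρ i N - c * (1 - c * ρ ^ (i + 1)) ^ N| ≤ F N := by
  have hC0 : 0 ≤ C := (uu_nonneg h0 0).trans (hC 0)
  have h1' : 0 < 1 - ρ := by linarith
  obtain ⟨B, hB⟩ : ∃ B : ℝ, ∀ j : ℕ, (j : ℝ) * √ρ ^ j ≤ B := by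
    have h := summable_pow_mul_geometric_of_norm_lt_one (R := ℝ) 1 (r := √ρ) (by
      rw [Real.norm_of_nonneg (Real.sqrt_nonneg _)]
      rw [Real.sqrt_lt' one_pos]; simpa using h1)
    have h2 := h.tendsto_atTop_zero.bddAbove_range
    obtain ⟨B, hB⟩ := h2
    refine ⟨B, fun j => ?_⟩
    have := hB (Set.mem_range_self j)
    simpa using this
  have hB0 : 0 ≤ B := by simpa using hB 0
  set h : ℕ → ℝ := fun N => C * (c * (B * √(Λ / N)) + Λ * (DD ρ c N / N)
      + C * (1 - ρ)⁻¹ * (Λ * (Λ / N))) with hh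
  have hinv : Tendsto (fun N : ℕ => Λ / (N : ℝ)) atTop (nhds 0) := tendsto_const_div_atTop_nhds_zero_nat Λ
  have hht : Tendsto h atTop (nhds 0) := by
    have hsq : Tendsto (fun N : ℕ => √(Λ / (N : ℝ))) atTop (nhds 0) := by
      have := (Real.continuous_sqrt.tendsto 0).comp hinv
      rw [Real.sqrt_zero] at this
      exact this
    have := ((((hsq.const_mul B).const_mul c).add ((DD_div hu).const_mul Λ)).add
      ((hinv.const_mul Λ).const_mul (C * (1 - ρ)⁻¹))).const_mul C
    simp only [mul_zero, add_zero] at this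
    exact this
  refine ⟨fun N => |uu ρ N - c| + h N + Real.exp (c * Λ) * (c * (Λ * (DD ρ c N / N)) + c * Λ * h N), ?_, ?_⟩
  · have h3 : Tendsto (fun n => |uu ρ n - c|) atTop (nhds 0) := by
      have := (hu.sub_const c).abs
      simpa using this
    have := (h3.add hht).add (((((DD_div hu).const_mul Λ).const_mul c).add (hht.const_mul (c * Λ))).const_mul
      (Real.exp (c * Λ)))
    simpa using this
  intro N hN i hi
  have hN0 : (0 : ℝ) < N := by exact_mod_cast hN
  have hp : 0 < ρ ^ (i + 1) := pow_pos h0 _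
  have hp' : ρ ^ (i + 1) ≤ Λ / N := by rw [le_div_iff₀ hN0]; linarith
  have hD := DD_nonneg ρ c N
  have e1 : ρ ^ (i + 1) * DD ρ c N ≤ Λ * (DD ρ c N / N) := by
    calc _ ≤ Λ / N * DD ρ c N := by gcongr
      _ = _ := by ring
  have e2 : ρ ^ (i + 1) * (i + 1 : ℕ) ≤ B * √(Λ / N) := by
    have : ρ ^ (i + 1) = √ρ ^ (i + 1) * √ρ ^ (i + 1) := by
      rw [← mul_pow, Real.mul_self_sqrt h0.le]
    have hs : √ρ ^ (i + 1) ≤ √(Λ / N) := by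
      apply Real.le_sqrt_of_sq_le
      rw [pow_two, ← this]; exact hp'
    calc _ = ((i + 1 : ℕ) * √ρ ^ (i + 1)) * √ρ ^ (i + 1) := by rw [this]; ring
      _ ≤ _ := by
        gcongr
        exact hB (i + 1)
  have e3 : N * ρ ^ (2 * (i + 1)) ≤ Λ * (Λ / N) := by
    calc N * ρ ^ (2 * (i + 1)) = (N * ρ ^ (i + 1)) * ρ ^ (i + 1) := by ring
      _ ≤ _ := by gcongr
  have hH : C * (ρ ^ (i + 1) * ((i + 1 : ℕ) * c + DD ρ c N) + N * (C * (ρ ^ (2 * (i + 1)) * (1 - ρ)⁻¹))) ≤ h N := by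
    simp only [hh]
    gcongr C * ?_
    calc _ = c * (ρ ^ (i + 1) * (i + 1 : ℕ)) + ρ ^ (i + 1) * DD ρ c N
          + C * (1 - ρ)⁻¹ * (N * ρ ^ (2 * (i + 1))) := by ring
      _ ≤ _ := by gcongr
  have hh0 : 0 ≤ h N := by simp only [hh]; positivity
  refine (mid_bound h0 h1 hC hc i N (h N) hH).trans ?_
  have e4 : (1 + c * ρ ^ (i + 1)) ^ N ≤ Real.exp (c * Λ) := by
    calc _ ≤ Real.exp (c * ρ ^ (i + 1)) ^ N := by
          gcongr
          rw [add_comm]; exact Real.add_one_le_exp _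
      _ = Real.exp (c * (N * ρ ^ (i + 1))) := by rw [← Real.exp_nat_mul]; ring_nf
      _ ≤ _ := by gcongr
  beta_reduce
  refine add_le_add le_rfl ?_
  calc c * ρ ^ (i + 1) * ((1 + c * ρ ^ (i + 1)) ^ N * (DD ρ c N + N * h N))
      = (1 + c * ρ ^ (i + 1)) ^ N * (c * (ρ ^ (i + 1) * DD ρ c N) + c * (N * ρ ^ (i + 1)) * h N) := by ring
    _ ≤ _ := by gcongr

lemma shift_dom {ρ K : ℝ} (h0 : 0 < ρ) (h1 : ρ < 1) (D : ℕ → ℕ → ℝ) (n0 : ℕ) (hn0 : 1 ≤ n0)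
    (ha : ∀ n, n0 ≤ n → ∀ i, |D n i| ≤ K * (n * ρ ^ i))
    (hb : ∀ n, n0 ≤ n → ∀ i, |D n i| * (n * ρ ^ i) ≤ K)
    (hcc : ∀ Λ : ℝ, 0 ≤ Λ → ∃ F : ℕ → ℝ, Tendsto F atTop (nhds 0) ∧
      ∀ n, n0 ≤ n → ∀ i, n * ρ ^ i ≤ Λ → |D n i| ≤ F n) :
    Tendsto (fun n => ∑' i, D n i) atTop (nhds 0) := by
  have hJ : ∀ n : ℕ, ∃ J : ℕ, n0 ≤ n → (ρ ^ (J + 1) < 1 / (n : ℝ) ∧ 1 / (n : ℝ) ≤ ρ ^ J) := by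
    intro n
    by_cases hn : n0 ≤ n
    · have hn1 : (1 : ℝ) ≤ n := by exact_mod_cast hn0.trans hn
      obtain ⟨J, hJ⟩ := exists_nat_pow_near_of_lt_one (x := 1 / (n : ℝ)) (y := ρ) (by positivity)
        (by rw [div_le_one (by linarith)]; exact hn1) h0 h1
      exact ⟨J, fun _ => hJ⟩
    · exact ⟨0, fun h => absurd h hn⟩
  choose J hJ using hJ
  set E : ℕ → ℤ → ℝ := fun n m => if 0 ≤ m then D n m.toNat else 0 with hE
  have hK0 : 0 ≤ K := le_trans (by positivity) (hb n0 le_rfl 0)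
  have hts : ∀ n, ∑' i, D n i = ∑' k : ℤ, E n (J n + k) := by
    intro n
    have e := (Equiv.addLeft (J n : ℤ)).tsum_eq (E n)
    simp only [Equiv.coe_addLeft] at e
    rw [e]
    rw [← Function.Injective.tsum_eq (f := E n) (g := fun i : ℕ => (i : ℤ)) Nat.cast_injective]
    · simp [hE]
    · intro m hm
      by_cases h : 0 ≤ m
      · exact ⟨m.toNat, by simp [h]⟩
      · exact absurd (by simp [hE, h]) hm
  -- position of the index
  have hpos : ∀ n, n0 ≤ n → ∀ k : ℤ, 0 ≤ (J n : ℤ) + k →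
      ρ ^ k ≤ n * ρ ^ ((J n : ℤ) + k).toNat ∧ n * ρ ^ ((J n : ℤ) + k).toNat ≤ ρ⁻¹ * ρ ^ k := by
    intro n hn k hk
    have hn1 : (0 : ℝ) < n := by exact_mod_cast hn0.trans hn
    have e : ρ ^ ((J n : ℤ) + k).toNat = ρ ^ (J n) * ρ ^ k := by
      rw [← zpow_natCast ρ ((J n : ℤ) + k).toNat, Int.toNat_of_nonneg hk, zpow_add₀ h0.ne', zpow_natCast]
    obtain ⟨j1, j2⟩ := hJ n hn
    rw [div_le_iff₀ hn1] at j2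
    rw [lt_div_iff₀ hn1, pow_succ] at j1
    have hk0 : 0 < ρ ^ k := zpow_pos h0 k
    rw [e]
    constructor
    · calc ρ ^ k = 1 * ρ ^ k := by ring
        _ ≤ (ρ ^ J n * n) * ρ ^ k := by gcongr
        _ = _ := by ring
    · have : n * ρ ^ J n ≤ ρ⁻¹ := by
        rw [← one_div, le_div_iff₀ h0]; linarith
      calc _ = (n * ρ ^ J n) * ρ ^ k := by ring
        _ ≤ _ := by gcongr
  have hbound : ∀ n, n0 ≤ n → ∀ k : ℤ, ‖E n (J n + k)‖ ≤ K * ρ⁻¹ * ρ ^ k.natAbs := by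
    intro n hn k
    simp only [hE]
    split_ifs with hk
    · obtain ⟨p1, p2⟩ := hpos n hn k hk
      have hk0 : 0 < ρ ^ k := zpow_pos h0 k
      rw [Real.norm_eq_abs]
      rcases le_total 0 k with hk1 | hk1
      · have e : ρ ^ k.natAbs = ρ ^ k := by
          rw [← zpow_natCast, Int.natAbs_of_nonneg hk1]
        rw [e]
        refine (ha n hn _).trans ?_
        rw [mul_assoc]
        gcongr
      · have e : ρ ^ k.natAbs = (ρ ^ k)⁻¹ := by
          rw [← zpow_natCast, Int.ofNat_natAbs_of_nonpos hk1, zpow_neg]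
        have hb' := hb n hn ((J n : ℤ) + k).toNat
        have hb2 : |D n ((J n : ℤ) + k).toNat| * ρ ^ k ≤ K := le_trans (by gcongr) hb'
        rw [e]
        have hinv : 1 ≤ ρ⁻¹ := (one_le_inv₀ h0).2 h1.le
        calc _ ≤ K * (ρ ^ k)⁻¹ := by
              rw [← div_eq_mul_inv, le_div_iff₀ hk0]; exact hb2
          _ ≤ _ := by
              gcongr
              exact le_mul_of_one_le_right hK0 hinv
    · rw [norm_zero]; positivity
  have hsumm : Summable (fun k : ℤ => K * ρ⁻¹ * ρ ^ k.natAbs) := by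
    apply Summable.mul_left
    have hg := summable_geometric_of_lt_one h0.le h1
    apply Summable.of_nat_of_neg
    · simpa using hg
    · simpa using hg
  have hlim : ∀ k : ℤ, Tendsto (fun n => E n (J n + k)) atTop (nhds 0) := by
    intro k
    obtain ⟨F, hF, hF2⟩ := hcc (ρ⁻¹ * ρ ^ k) (by have := zpow_pos h0 k; positivity)
    have hF' : Tendsto (fun n => |F n|) atTop (nhds 0) := by simpa using hF.abs
    refine squeeze_zero_norm' ?_ hF'
    filter_upwards [eventually_ge_atTop n0] with n hn
    simp only [hE]
    split_ifs with hk
    · rw [Real.norm_eq_abs]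
      exact (hF2 n hn _ (hpos n hn k hk).2).trans (le_abs_self _)
    · simp
  simp only [hts]
  have := tendsto_tsum_of_dominated_convergence (𝓕 := atTop) (f := fun n k => E n (J n + k))
    (g := fun _ => (0 : ℝ)) hsumm hlim (by
      filter_upwards [eventually_ge_atTop n0] with n hn
      exact hbound n hn)
  simpa using this

lemma one_sub_pow_le {y : ℝ} (hy0 : 0 ≤ y) (hy : y ≤ 3 / 2) (n : ℕ) : |1 - (1 - y) ^ n| ≤ n * y := by
  induction n with
  | zero => simp
  | succ n ih =>
    have e : 1 - (1 - y) ^ (n + 1) = (1 - (1 - y) ^ n) + (1 - y) ^ n * y := by ring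
    rw [e]
    refine (abs_add_le _ _).trans ?_
    have : |(1 - y) ^ n * y| ≤ y := by
      rw [abs_mul, abs_pow, abs_of_nonneg hy0]
      apply mul_le_of_le_one_left hy0
      apply pow_le_one₀ (abs_nonneg _)
      rw [abs_le]
      constructor <;> linarith
    push_cast
    linarith

lemma pow_mul_le {y : ℝ} (hy0 : 0 ≤ y) (hy : y ≤ 3 / 2) (n : ℕ) : |(1 - y) ^ n| * (n * y) ≤ 3 := by
  have h1 : |1 - y| ≤ Real.exp (-(y / 3)) := by
    refine le_trans ?_ (Real.add_one_le_exp _)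
    rw [abs_le]
    constructor <;> linarith
  have h2 : |(1 - y) ^ n| ≤ Real.exp (-(n * y / 3)) := by
    rw [abs_pow]
    calc _ ≤ Real.exp (-(y / 3)) ^ n := by gcongr
      _ = _ := by rw [← Real.exp_nat_mul]; congr 1; ring
  have h3 : n * y / 3 ≤ Real.exp (n * y / 3) := by linarith [Real.add_one_le_exp (n * y / 3)]
  calc _ ≤ Real.exp (-(n * y / 3)) * (3 * Real.exp (n * y / 3)) := by
        exact mul_le_mul h2 (by linarith) (by positivity) (Real.exp_pos _).le
    _ = 3 * (Real.exp (-(n * y / 3)) * Real.exp (n * y / 3)) := by ring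
    _ = 3 := by rw [← Real.exp_add]; simp

lemma main_tsum {ρ c : ℝ} (h0 : 0 < ρ) (h1 : ρ < 1) (hs : sigmaFn ρ = 1) (hc : 0 < c)
    (hu : Tendsto (uu ρ) atTop (nhds c)) (hy : ∀ i : ℕ, c * ρ ^ (i + 1) ≤ 3 / 2) :
    Tendsto (fun n => ∑' i, ((1 - c * ρ ^ (i + 1)) ^ n - vv ρ i n / uu ρ n)) atTop (nhds 0) := by
  obtain ⟨C, hC'⟩ := hu.bddAbove_range
  have hC : ∀ n, uu ρ n ≤ C := fun n => hC' (Set.mem_range_self n)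
  have hC0 : 0 ≤ C := (uu_nonneg h0 0).trans (hC 0)
  have h1' : 0 < 1 - ρ := by linarith
  obtain ⟨W, hW0, hW⟩ := lower_bound h0 h1 hs hC
  have hev : ∀ᶠ n in atTop, c / 2 ≤ uu ρ n := by
    filter_upwards [hu.eventually_const_lt (show c / 2 < c by linarith)] with n hn using hn.le
  obtain ⟨n1, hn1⟩ := eventually_atTop.1 hev
  set K1 : ℝ := c + 2 * (C * (C * (1 - ρ)⁻¹)) * (2 / c) with hK1
  set K2 : ℝ := (3 + 2 * W) / (c * ρ) with hK2
  have hK10 : 0 ≤ K1 := by positivity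
  have hK20 : 0 ≤ K2 := by positivity
  have hupos : ∀ n, max 1 n1 ≤ n → c / 2 ≤ uu ρ n := fun n hn => hn1 n ((le_max_right _ _).trans hn)
  apply shift_dom (K := K1 + K2) h0 h1 _ (max 1 n1) (le_max_left _ _)
  · intro n hn i
    have hn1' : (1 : ℝ) ≤ n := by exact_mod_cast (le_max_left _ _).trans hn
    have hun := hupos n hn
    have hup : 0 < uu ρ n := by linarith
    have e : (1 - c * ρ ^ (i + 1)) ^ n - vv ρ i n / uu ρ n
        = (uu ρ n - vv ρ i n) / uu ρ n - (1 - (1 - c * ρ ^ (i + 1)) ^ n) := by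
      field_simp; ring
    rw [e]
    refine (abs_sub _ _).trans ?_
    have hpp : ρ ^ (i + 1) ≤ ρ ^ i := pow_le_pow_of_le_one h0.le h1.le (by omega)
    have a1 : |1 - (1 - c * ρ ^ (i + 1)) ^ n| ≤ c * (n * ρ ^ i) := by
      refine (one_sub_pow_le (by positivity) (hy i) n).trans ?_
      calc n * (c * ρ ^ (i + 1)) ≤ n * (c * ρ ^ i) := by gcongr
        _ = _ := by ring
    have a2 : |(uu ρ n - vv ρ i n) / uu ρ n| ≤ 2 * (C * (C * (1 - ρ)⁻¹)) * (2 / c) * (n * ρ ^ i) := by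
      rw [abs_of_nonneg (div_nonneg (sub_nonneg.2 (vv_le_uu h0 i n)) hup.le)]
      have b := upper_bound h0 h1 hC i n
      calc (uu ρ n - vv ρ i n) / uu ρ n ≤ ((n + 1) * (C * (C * (ρ ^ (i + 1) * (1 - ρ)⁻¹)))) / (c / 2) := by
            gcongr
        _ ≤ ((n + n) * (C * (C * (ρ ^ i * (1 - ρ)⁻¹)))) / (c / 2) := by gcongr
        _ = _ := by field_simp; ring
    have : 0 ≤ K2 * (n * ρ ^ i) := by positivity
    rw [add_mul, hK1, add_mul]
    linarith
  · intro n hn i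
    have hn1' : (1 : ℝ) ≤ n := by exact_mod_cast (le_max_left _ _).trans hn
    have hun := hupos n hn
    have hup : 0 < uu ρ n := by linarith
    have a1 := pow_mul_le (by positivity) (hy i) n
    have a2 := hW i n
    have hv := vv_nonneg h0 i n
    have a3 : vv ρ i n / uu ρ n ≤ vv ρ i n / (c / 2) := by gcongr
    have a4 : |(1 - c * ρ ^ (i + 1)) ^ n - vv ρ i n / uu ρ n|
        ≤ |(1 - c * ρ ^ (i + 1)) ^ n| + vv ρ i n / (c / 2) := by
      refine (abs_sub _ _).trans ?_
      rw [abs_of_nonneg (div_nonneg hv hup.le)]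
      gcongr
    have a5 : |(1 - c * ρ ^ (i + 1)) ^ n - vv ρ i n / uu ρ n| * (n * ρ ^ i) ≤ K2 := by
      calc _ ≤ (|(1 - c * ρ ^ (i + 1)) ^ n| + vv ρ i n / (c / 2)) * (n * ρ ^ i) := by gcongr
        _ = (|(1 - c * ρ ^ (i + 1)) ^ n| * (n * (c * ρ ^ (i + 1))) + 2 * (n * vv ρ i n * ρ ^ (i + 1))) / (c * ρ) := by
          field_simp
          ring
        _ ≤ _ := by
          rw [hK2]
          gcongr
    linarith
  · intro Λ hΛ
    obtain ⟨F, hF, hF2⟩ := mid h0 h1 hC hc.le hu Λ hΛ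
    refine ⟨fun n => F n / c + C * |1 / c - 1 / uu ρ n|, ?_, ?_⟩
    · have t1 : Tendsto (fun n => |1 / c - 1 / uu ρ n|) atTop (nhds 0) := by
        have := ((tendsto_const_nhds (x := 1 / c)).sub ((tendsto_const_nhds (x := (1 : ℝ))).div hu hc.ne')).abs
        simpa using this
      have := (hF.div_const c).add (t1.const_mul C)
      simp only [zero_div, mul_zero, add_zero] at this
      exact this
    · intro n hn i hi
      have hn1' : 1 ≤ n := (le_max_left _ _).trans hn
      have hun := hupos n hn
      have hup : 0 < uu ρ n := by linarith
      have hpp : ρ ^ (i + 1) ≤ ρ ^ i := pow_le_pow_of_le_one h0.le h1.le (by omega)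
      have b := hF2 n hn1' i (le_trans (by gcongr) hi)
      have e : (1 - c * ρ ^ (i + 1)) ^ n - vv ρ i n / uu ρ n
          = -(vv ρ i n - c * (1 - c * ρ ^ (i + 1)) ^ n) / c + vv ρ i n * (1 / c - 1 / uu ρ n) := by
        field_simp; ring
      rw [e]
      refine (abs_add_le _ _).trans ?_
      rw [abs_div, abs_neg, abs_of_pos hc, abs_mul, abs_of_nonneg (vv_nonneg h0 i n)]
      have hvC := (vv_le_uu h0 i n).trans (hC n)
      beta_reduce
      gcongr

/-- With `ρ` the unique solution of `σ(z) = 1` in `(0,1)` and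
`α = 1/σ'(ρ)`, as `n → ∞`,
`∑_{j=1}^n (1 - a_{n,j}/a_n) - ∑_{j=0}^∞ (1 - (1 - ρ^j α)^n) → 0`. -/
theorem key_sum_asymptotics (ρ : ℝ)
    (hρ : ρ ∈ Set.Ioo (0 : ℝ) 1 ∧ sigmaFn ρ = 1)
    (hρu : ∀ x ∈ Set.Ioo (0 : ℝ) 1, sigmaFn x = 1 → x = ρ)
    (α : ℝ) (hα : α = 1 / deriv sigmaFn ρ) :
    Tendsto (fun n : ℕ =>
        (∑ j ∈ Finset.Icc 1 n,
            (1 - (carlitzCountAvoid n j : ℝ) / (carlitzCount n : ℝ))) -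
          ∑' j : ℕ, (1 - (1 - ρ ^ j * α) ^ n))
      atTop (nhds 0) := by
  obtain ⟨⟨h0, h1⟩, hs⟩ := hρ
  have hd := sigma_deriv_ge h0 h1
  have hd0 : 0 < deriv sigmaFn ρ := by linarith
  set c := 1 / (ρ * deriv sigmaFn ρ) with hc
  have hc0 : 0 < c := by positivity
  have hu : Tendsto (uu ρ) atTop (nhds c) := u_tendsto h0 h1 hs
  have hyα : ∀ i : ℕ, c * ρ ^ (i + 1) = ρ ^ i * α := by
    intro i
    rw [hc, hα, pow_succ]
    field_simp
  have hy : ∀ i : ℕ, c * ρ ^ (i + 1) ≤ 3 / 2 := by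
    intro i
    rw [hyα, hα]
    have e1 : ρ ^ i ≤ 1 := pow_le_one₀ h0.le h1.le
    have e2 : 1 / deriv sigmaFn ρ ≤ 3 / 2 := by
      rw [div_le_iff₀ hd0]; linarith
    calc ρ ^ i * (1 / deriv sigmaFn ρ) ≤ 1 * (3 / 2) := by gcongr
      _ = _ := by ring
  have hmain := main_tsum h0 h1 hs hc0 hu hy
  refine hmain.congr' ?_
  filter_upwards [hu.eventually_const_lt hc0] with n hn
  have hzero : ∀ i, i ∉ Finset.range n → 1 - vv ρ i n / uu ρ n = 0 := by
    intro i hi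
    have hi' : n < i + 1 := by
      have := Finset.mem_range.not.1 hi
      omega
    have : vv ρ i n = uu ρ n := by
      unfold vv uu
      rw [cT_avoid_large hi']
    rw [this, div_self hn.ne', sub_self]
  have hsum1 : ∑ j ∈ Finset.Icc 1 n, (1 - (carlitzCountAvoid n j : ℝ) / (carlitzCount n : ℝ))
      = ∑' i, (1 - vv ρ i n / uu ρ n) := by
    have e := Finset.sum_Ico_add' (fun j => (1 - ((cT (fun x => x ≠ j) n : ℝ) * ρ ^ n) / uu ρ n)) 0 n 1
    rw [tsum_eq_sum hzero, Finset.range_eq_Ico]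
    refine Eq.trans ?_ e.symm
    apply Finset.sum_congr
    · ext j; simp only [Finset.mem_Icc, Finset.mem_Ico]; omega
    · intro j _
      rw [carlitzCount_eq, carlitzCountAvoid_eq, uu, mul_div_mul_right _ _ (pow_pos h0 n).ne']
  have hS1 : Summable (fun i => 1 - vv ρ i n / uu ρ n) := summable_of_ne_finset_zero hzero
  have hS2 : Summable (fun i : ℕ => 1 - (1 - ρ ^ i * α) ^ n) := by
    refine Summable.of_norm_bounded (g := fun i : ℕ => n * (ρ ^ i * α))
      (((summable_geometric_of_lt_one h0.le h1).mul_right α).mul_left (n : ℝ)) ?_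
    intro i
    rw [Real.norm_eq_abs, ← hyα]
    exact one_sub_pow_le (by positivity) (hy i) n
  rw [hsum1, ← hS1.tsum_sub hS2]
  apply tsum_congr
  intro i
  rw [hyα]
  ring
end

section
/- Let E D_n denote the average number of distinct part sizes over all Carlitz compositions of n, and let ρ be the unique real solution of σ(z) = 1 in (0,1). Then E D_n / ln n → 1/ln(1/ρ) as n → ∞. -/
open Filter

/-- `distinctCount L` is the number of distinct part sizes of `L`. -/
def distinctCount (L : List ℕ) : ℕ :=
  L.dedup.length

/-- `avgDistinct n = E D_n`, the average number of distinct part sizes over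
all Carlitz compositions of `n`. -/
noncomputable def avgDistinct (n : ℕ) : ℝ :=
  (∑ᶠ γ : {L : List ℕ // IsComposition n L ∧ IsCarlitz L},
      (distinctCount (γ : List ℕ) : ℝ)) / (carlitzCount n : ℝ)

/-- Carlitz compositions of `n` all of whose parts satisfy `P`. -/
def OmS (P : ℕ → Prop) (n : ℕ) : Set (List ℕ) :=
  {L | (IsComposition n L ∧ IsCarlitz L) ∧ ∀ x ∈ L, P x}

theorem OmS_finite (P : ℕ → Prop) (n : ℕ) : (OmS P n).Finite := by
  apply (Set.finite_range (fun c : Composition n => c.blocks)).subset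
  rintro L ⟨⟨⟨h1, h2⟩, -⟩, -⟩
  exact ⟨⟨L, fun {i} hi => h1 i hi, h2⟩, rfl⟩

noncomputable def OmF (P : ℕ → Prop) (n : ℕ) : Finset (List ℕ) := (OmS_finite P n).toFinset

theorem mem_OmF {P : ℕ → Prop} {n : ℕ} {L : List ℕ} :
    L ∈ OmF P n ↔ (((∀ x ∈ L, 0 < x) ∧ L.sum = n) ∧ L.IsChain (· ≠ ·)) ∧ ∀ x ∈ L, P x := by
  simp [OmF, OmS, IsComposition, IsCarlitz, List.Chain']

noncomputable def Cnt (P : ℕ → Prop) (n : ℕ) : ℕ := (OmF P n).card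

noncomputable def HC (P : ℕ → Prop) (n b : ℕ) : ℕ :=
  ((OmF P n).filter (fun L => L.head? = some b)).card

theorem HC_rec (P : ℕ → Prop) (n b : ℕ) (hb : 0 < b) (hP : P b) :
    HC P (n + b) b + HC P n b = Cnt P n := by
  have h : HC P (n + b) b = ((OmF P n).filter (fun L => ¬ L.head? = some b)).card := by
    unfold HC
    rw [← Finset.card_image_of_injective (f := List.cons b)
      ((OmF P n).filter (fun L => ¬ L.head? = some b)) (List.cons_injective)]
    congr 1
    ext L
    simp only [Finset.mem_filter, Finset.mem_image, mem_OmF]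
    constructor
    · rintro ⟨⟨⟨⟨h1, h2⟩, h3⟩, h4⟩, h5⟩
      cases L with
      | nil => simp at h5
      | cons c L =>
        simp only [List.head?_cons, Option.some.injEq] at h5
        subst h5
        rw [List.isChain_cons] at h3
        simp only [List.mem_cons, forall_eq_or_imp] at h1 h4
        rw [List.sum_cons] at h2
        refine ⟨L, ⟨⟨⟨⟨h1.2, by omega⟩, h3.2⟩, h4.2⟩, ?_⟩, rfl⟩
        intro h
        exact h3.1 c (by simp [h]) rfl
    · rintro ⟨L', ⟨⟨⟨⟨h1, h2⟩, h3⟩, h4⟩, h5⟩, rfl⟩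
      refine ⟨⟨⟨⟨?_, ?_⟩, ?_⟩, ?_⟩, rfl⟩
      · simp only [List.mem_cons, forall_eq_or_imp]; exact ⟨hb, h1⟩
      · rw [List.sum_cons]; omega
      · rw [List.isChain_cons]
        refine ⟨?_, h3⟩
        rintro y hy rfl
        exact h5 (by simpa using hy)
      · simp only [List.mem_cons, forall_eq_or_imp]; exact ⟨hP, h4⟩
  rw [h, add_comm]
  exact Finset.card_filter_add_card_filter_not _

theorem Cnt_zero (P : ℕ → Prop) : Cnt P 0 = 1 := by
  unfold Cnt
  rw [Finset.card_eq_one]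
  refine ⟨[], ?_⟩
  ext L
  simp only [mem_OmF, Finset.mem_singleton]
  constructor
  · rintro ⟨⟨⟨h1, h2⟩, -⟩, -⟩
    cases L with
    | nil => rfl
    | cons c L =>
      have := h1 c (by simp)
      simp at h2; omega
  · rintro rfl; simp

theorem HC_eq_zero (P : ℕ → Prop) (n b : ℕ) (h : ¬ (b ∈ Finset.Icc 1 n ∧ P b)) :
    HC P n b = 0 := by
  unfold HC
  rw [Finset.card_eq_zero, Finset.filter_eq_empty_iff]
  intro L hL hb
  rw [mem_OmF] at hL
  obtain ⟨⟨⟨h1, h2⟩, -⟩, h4⟩ := hL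
  have hm : b ∈ L := List.mem_of_mem_head? (by simp [hb])
  apply h
  have := List.le_sum_of_mem hm
  have := h1 b hm
  simp only [Finset.mem_Icc]
  exact ⟨⟨by omega, by omega⟩, h4 b hm⟩

theorem Cnt_eq_sum (P : ℕ → Prop) (n : ℕ) (hn : 0 < n) :
    Cnt P n = ∑ b ∈ Finset.Icc 1 n, HC P n b := by
  unfold Cnt HC
  rw [Finset.card_eq_sum_card_fiberwise (f := fun L => L.headD 0) (t := Finset.Icc 1 n)]
  · apply Finset.sum_congr rfl
    intro b hb
    congr 1
    ext L
    simp only [Finset.mem_filter, Finset.mem_Icc] at *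
    cases L with
    | nil => simp; omega
    | cons c L => simp
  · intro L hL
    have hL := mem_OmF.1 (Finset.mem_coe.1 hL)
    obtain ⟨⟨⟨h1, h2⟩, -⟩, h4⟩ := hL
    cases L with
    | nil => simp at h2; omega
    | cons c L =>
      have := h1 c (by simp)
      simp at h2 ⊢; omega

theorem HC_le (P : ℕ → Prop) (n b : ℕ) : HC P n b ≤ Cnt P n := Finset.card_filter_le _ _

theorem HC_add_le (P : ℕ → Prop) (n b c : ℕ) (h : b ≠ c) : HC P n b + HC P n c ≤ Cnt P n := by
  unfold HC Cnt
  rw [← Finset.card_union_of_disjoint]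
  · apply Finset.card_le_card
    intro L; simp only [Finset.mem_union, Finset.mem_filter]; tauto
  · rw [Finset.disjoint_filter]
    intro L _ h1 h2
    rw [h1] at h2; simp at h2; exact h h2

/-- the predicate allowing all parts -/
def Tr : ℕ → Prop := fun _ => True

theorem Cnt_mono (n t : ℕ) (ht : 3 ≤ t) : Cnt Tr n ≤ Cnt Tr (n + t) := by
  have e1 := HC_rec Tr n t (by omega) trivial
  have e2 := HC_rec Tr n 1 (by omega) trivial
  have e3 := HC_add_le Tr n t 1 (by omega)
  have e4 := HC_rec Tr (n + 1) (t - 1) (by omega) trivial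
  have e5 := HC_add_le Tr (n + 1) (t - 1) 1 (by omega)
  have e6 := HC_add_le Tr (n + t) t (t - 1) (by omega)
  rw [show n + 1 + (t - 1) = n + t by omega] at e4
  omega

/-- weights -/
noncomputable def wt (z : ℝ) (b : ℕ) : ℝ := z ^ b / (1 + z ^ b)

/-- Generating function bound. -/
theorem Cnt_bound (P : ℕ → Prop) [DecidablePred P] (z : ℝ) (hz : 0 < z) (n : ℕ) (d : ℝ) (hd : 0 < d)
    (h : ∑ b ∈ (Finset.Icc 1 n).filter P, wt z b ≤ 1 - d) :
    (Cnt P n : ℝ) * z ^ n ≤ 1 / d := by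
  set A : ℝ := ∑ i ∈ Finset.range (n + 1), (Cnt P i : ℝ) * z ^ i with hA
  have hA0 : 0 ≤ A := Finset.sum_nonneg (fun i _ => by positivity)
  have hle : (Cnt P n : ℝ) * z ^ n ≤ A :=
    Finset.single_le_sum (f := fun i => (Cnt P i : ℝ) * z ^ i)
      (fun i _ => by positivity) (by simp)
  have hb : ∀ b ∈ (Finset.Icc 1 n).filter P,
      ∑ i ∈ Finset.range (n + 1), (HC P i b : ℝ) * z ^ i ≤ wt z b * A := by
    intro b hb
    simp only [Finset.mem_filter, Finset.mem_Icc] at hb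
    set B : ℝ := ∑ i ∈ Finset.range (n + 1), (HC P i b : ℝ) * z ^ i with hB
    have h1 : B ≤ ∑ i ∈ Finset.range (n + 1), (HC P (i + b) b : ℝ) * z ^ (i + b) := by
      have e : ∑ i ∈ Finset.range (n + 1), (HC P (i + b) b : ℝ) * z ^ (i + b)
          = ∑ i ∈ Finset.Ico b (n + 1 + b), (HC P i b : ℝ) * z ^ i := by
        rw [Finset.sum_Ico_eq_sum_range]
        apply Finset.sum_congr (by congr 1; omega)
        intro i _; rw [add_comm]
      rw [e, hB]
      rw [← Finset.sum_subset (s₁ := Finset.Ico b (n + 1)) (s₂ := Finset.range (n + 1))]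
      · apply Finset.sum_le_sum_of_subset_of_nonneg
        · intro i; simp only [Finset.mem_Ico]; omega
        · intros; positivity
      · intro i; simp
      · intro i hi hi'
        rw [HC_eq_zero]; · simp
        · simp only [Finset.mem_Ico, Finset.mem_range, Finset.mem_Icc] at *; omega
    have h2 : ∑ i ∈ Finset.range (n + 1), (HC P (i + b) b : ℝ) * z ^ (i + b) = z ^ b * (A - B) := by
      rw [hA, hB, ← Finset.sum_sub_distrib, Finset.mul_sum]
      apply Finset.sum_congr rfl
      intro i _
      rw [← HC_rec P i b (by omega) hb.2]
      push_cast; ring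
    have hzb : 0 < z ^ b := by positivity
    rw [wt, div_mul_eq_mul_div, le_div_iff₀ (by positivity)]
    nlinarith
  have hS : A ≤ 1 + (1 - d) * A := by
    have e : A = 1 + ∑ b ∈ (Finset.Icc 1 n).filter P,
        ∑ i ∈ Finset.range (n + 1), (HC P i b : ℝ) * z ^ i := by
      rw [Finset.sum_comm, hA, Finset.sum_range_succ', Finset.sum_range_succ' (n := n)]
      have h0 : ∑ b ∈ (Finset.Icc 1 n).filter P, (HC P 0 b : ℝ) * z ^ 0 = 0 := by
        apply Finset.sum_eq_zero
        intro b hb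
        rw [HC_eq_zero]; · simp
        · simp
      rw [h0, Cnt_zero]
      have : ∑ k ∈ Finset.range n, (Cnt P (k + 1) : ℝ) * z ^ (k + 1) =
          ∑ k ∈ Finset.range n, ∑ b ∈ (Finset.Icc 1 n).filter P, (HC P (k + 1) b : ℝ) * z ^ (k + 1) := by
        apply Finset.sum_congr rfl
        intro k hk
        rw [Cnt_eq_sum P (k + 1) (by omega), ← Finset.sum_mul]
        congr 1
        push_cast
        have s1 := Finset.sum_subset (s₁ := (Finset.Icc 1 (k+1)).filter P) (s₂ := Finset.Icc 1 (k+1))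
          (f := fun b => (HC P (k+1) b : ℝ)) (by intro i; simp; tauto)
          (by intro x hx hx'
              rw [HC_eq_zero]; · simp
              · simpa using hx')
        have s2 := Finset.sum_subset (s₁ := (Finset.Icc 1 (k+1)).filter P) (s₂ := (Finset.Icc 1 n).filter P)
          (f := fun b => (HC P (k+1) b : ℝ))
          (by intro i; simp only [Finset.mem_filter, Finset.mem_Icc, Finset.mem_range] at *
              rintro ⟨⟨h1, h2⟩, h3⟩
              exact ⟨⟨h1, by omega⟩, h3⟩)
          (by intro x hx hx'
              rw [HC_eq_zero]; · simp
              · simpa using hx')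
        rw [← s1, s2]
      rw [this]; simp; ring
    have := Finset.sum_le_sum hb
    rw [← Finset.sum_mul] at this
    have h3 := mul_le_mul_of_nonneg_right h hA0
    linarith
  rw [le_div_iff₀ hd]
  nlinarith

theorem hasSum_wt (ρ : ℝ) (h0 : 0 < ρ) (h1 : ρ < 1) (hs : sigmaFn ρ = 1) :
    HasSum (fun b : ℕ => wt ρ (b + 1)) 1 := by
  have hgeo : Summable (fun n : ℕ => ρ ^ n) := summable_geometric_of_lt_one h0.le h1
  have hsum : Summable (fun p : ℕ × ℕ => (-1 : ℝ) ^ p.1 * (ρ ^ ((p.2 + 1) * (p.1 + 1)))) := by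
    have hp : Summable (fun p : ℕ × ℕ => ρ ^ p.1 * ρ ^ p.2) :=
      hgeo.mul_of_nonneg hgeo (fun n => by positivity) (fun n => by positivity)
    refine Summable.of_norm_bounded hp ?_
    rintro ⟨l, k⟩
    rw [norm_mul, norm_pow, norm_neg, norm_one, one_pow, one_mul, Real.norm_of_nonneg (by positivity),
      ← pow_add]
    apply pow_le_pow_of_le_one h0.le h1.le
    dsimp only
    nlinarith [Nat.zero_le (k * l)]
  have e1 : ∀ l : ℕ, HasSum (fun k : ℕ => (-1 : ℝ) ^ l * (ρ ^ ((k + 1) * (l + 1))))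
      ((-1 : ℝ) ^ l * ρ ^ (l + 1) / (1 - ρ ^ (l + 1))) := by
    intro l
    have hl : ρ ^ (l + 1) < 1 := pow_lt_one₀ h0.le h1 (by omega)
    have := (hasSum_geometric_of_lt_one (by positivity) hl).mul_left ((-1 : ℝ) ^ l * ρ ^ (l + 1))
    rw [← div_eq_mul_inv] at this
    refine Eq.mpr (congrArg (fun f => HasSum f _) (funext fun k => ?_)) this
    rw [← pow_mul]; ring
  have e2 : ∀ k : ℕ, HasSum (fun l : ℕ => (-1 : ℝ) ^ l * (ρ ^ ((k + 1) * (l + 1))))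
      (wt ρ (k + 1)) := by
    intro k
    have hl : ρ ^ (k + 1) < 1 := pow_lt_one₀ h0.le h1 (by omega)
    have hp : 0 < ρ ^ (k + 1) := by positivity
    have := (hasSum_geometric_of_abs_lt_one (r := -(ρ ^ (k + 1)))
      (by rw [abs_neg, abs_of_pos hp]; exact hl)).mul_left (ρ ^ (k + 1))
    rw [← div_eq_mul_inv, sub_neg_eq_add] at this
    refine Eq.mpr (congrArg (fun f => HasSum f _) (funext fun l => ?_)) this
    rw [neg_pow (ρ ^ (k + 1)), ← pow_mul]; ring
  have hs1 := hsum.hasSum.prod_fiberwise e1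
  have hS : ∑' p : ℕ × ℕ, (-1 : ℝ) ^ p.1 * (ρ ^ ((p.2 + 1) * (p.1 + 1))) = 1 := by
    exact hs1.tsum_eq.symm.trans hs
  have hsw : HasSum (fun p : ℕ × ℕ => (-1 : ℝ) ^ p.2 * (ρ ^ ((p.1 + 1) * (p.2 + 1)))) 1 := by
    have := hsum.hasSum
    rw [hS] at this
    exact (Equiv.prodComm ℕ ℕ).hasSum_iff.2 this
  exact hsw.prod_fiberwise e2

theorem wt_nonneg (z : ℝ) (hz : 0 < z) (b : ℕ) : 0 ≤ wt z b := by unfold wt; positivity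

theorem sum_wt_Icc (z : ℝ) (n : ℕ) :
    ∑ b ∈ Finset.Icc 1 n, wt z b = ∑ b ∈ Finset.range n, wt z (b + 1) := by
  rw [Finset.range_eq_Ico, Finset.sum_Ico_add' (fun b => wt z b) 0 n 1]
  rfl

theorem sum_wt_le (ρ : ℝ) (h0 : 0 < ρ) (h1 : ρ < 1) (hs : sigmaFn ρ = 1) (n : ℕ) :
    ∑ b ∈ Finset.Icc 1 n, wt ρ b ≤ 1 := by
  rw [sum_wt_Icc]
  exact sum_le_hasSum _ (fun i _ => wt_nonneg ρ h0 _) (hasSum_wt ρ h0 h1 hs)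

theorem tail_wt_le (ρ : ℝ) (h0 : 0 < ρ) (h1 : ρ < 1) (hs : sigmaFn ρ = 1) (n : ℕ) :
    1 - ∑ b ∈ Finset.Icc 1 n, wt ρ b ≤ ρ ^ n / (1 - ρ) := by
  rw [sum_wt_Icc]
  have h := (hasSum_nat_add_iff' n).2 (hasSum_wt ρ h0 h1 hs)
  have g := (hasSum_geometric_of_lt_one h0.le h1).mul_left (ρ ^ n)
  rw [← div_eq_mul_inv] at g
  refine hasSum_le ?_ h g
  intro i
  unfold wt
  have : 0 < ρ ^ (i + n + 1) := by positivity
  calc ρ ^ (i + n + 1) / (1 + ρ ^ (i + n + 1)) ≤ ρ ^ (i + n + 1) :=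
        div_le_self this.le (by linarith)
    _ ≤ ρ ^ (i + n) := pow_le_pow_of_le_one h0.le h1.le (by omega)
    _ = ρ ^ n * ρ ^ i := by ring

/-- the straddling term -/
noncomputable def Tm (ρ : ℝ) (n i : ℕ) : ℝ :=
  (Cnt Tr i : ℝ) - ∑ c ∈ Finset.Icc 1 (n - i), wt ρ c * ((Cnt Tr i : ℝ) - HC Tr i c)
    - ∑ c ∈ Finset.Icc 1 i, wt ρ c * (HC Tr i c : ℝ)

theorem T_eq (ρ : ℝ) (h0 : 0 < ρ) (n : ℕ) :
    ∑ i ∈ Finset.range (n + 1), ρ ^ i * Tm ρ n i = 1 := by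
  induction n with
  | zero => simp [Tm, Cnt_zero]
  | succ n ih =>
    rw [Finset.sum_range_succ]
    have hdiff : ∀ i ∈ Finset.range (n + 1), ρ ^ i * Tm ρ (n + 1) i
        = ρ ^ i * Tm ρ n i
          - ρ ^ (n + 1) * ((1 / (1 + ρ ^ (n + 1 - i))) * (HC Tr (n + 1) (n + 1 - i) : ℝ)) := by
      intro i hi
      have hi : i ≤ n := by simp at hi; omega
      unfold Tm
      rw [show n + 1 - i = (n - i) + 1 by omega, Finset.sum_Icc_succ_top (by omega)]
      have hr := HC_rec Tr i (n - i + 1) (by omega) trivial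
      rw [show i + (n - i + 1) = n + 1 by omega] at hr
      have hr' : (Cnt Tr i : ℝ) - HC Tr i (n - i + 1) = HC Tr (n + 1) (n - i + 1) := by
        rw [← hr]; push_cast; ring
      rw [hr']
      have hp : ρ ^ (n + 1) = ρ ^ i * ρ ^ (n - i + 1) := by rw [← pow_add]; congr 1; omega
      rw [hp]
      unfold wt
      ring
    rw [Finset.sum_congr rfl hdiff, Finset.sum_sub_distrib, ih]
    have hrefl : ∑ i ∈ Finset.range (n + 1),
        ρ ^ (n + 1) * ((1 / (1 + ρ ^ (n + 1 - i))) * (HC Tr (n + 1) (n + 1 - i) : ℝ))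
        = ∑ c ∈ Finset.Icc 1 (n + 1),
        ρ ^ (n + 1) * ((1 / (1 + ρ ^ c)) * (HC Tr (n + 1) c : ℝ)) := by
      apply Finset.sum_bij' (fun i _ => n + 1 - i) (fun c _ => n + 1 - c)
      all_goals intro i hi
      all_goals simp only [Finset.mem_range, Finset.mem_Icc] at *
      all_goals omega
    rw [hrefl]
    have hT : Tm ρ (n + 1) (n + 1) = ∑ c ∈ Finset.Icc 1 (n + 1),
        (1 / (1 + ρ ^ c)) * (HC Tr (n + 1) c : ℝ) := by
      unfold Tm
      rw [Cnt_eq_sum Tr (n + 1) (by omega)]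
      simp only [Nat.sub_self, Finset.Icc_eq_empty_of_lt (Nat.zero_lt_one), Finset.sum_empty, sub_zero]
      push_cast
      rw [← Finset.sum_sub_distrib]
      apply Finset.sum_congr rfl
      intro c _
      have : 0 < ρ ^ c := by positivity
      unfold wt
      field_simp
      ring
    rw [hT, ← Finset.mul_sum]
    ring

theorem HC_cast_le (P : ℕ → Prop) (n b : ℕ) : (HC P n b : ℝ) ≤ Cnt P n := by
  exact_mod_cast HC_le P n b

theorem Tm_nonneg (ρ : ℝ) (h0 : 0 < ρ) (h1 : ρ < 1) (hs : sigmaFn ρ = 1) (n i : ℕ) (hi : i ≤ n) :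
    0 ≤ Tm ρ n i := by
  unfold Tm
  have a1 : ∑ c ∈ Finset.Icc 1 (n - i), wt ρ c * ((Cnt Tr i : ℝ) - HC Tr i c)
      ≤ ∑ c ∈ Finset.Icc 1 n, wt ρ c * ((Cnt Tr i : ℝ) - HC Tr i c) := by
    apply Finset.sum_le_sum_of_subset_of_nonneg
    · apply Finset.Icc_subset_Icc_right; omega
    · intro c _ _
      exact mul_nonneg (wt_nonneg ρ h0 c) (sub_nonneg.2 (HC_cast_le _ _ _))
  have a2 : ∑ c ∈ Finset.Icc 1 i, wt ρ c * (HC Tr i c : ℝ)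
      ≤ ∑ c ∈ Finset.Icc 1 n, wt ρ c * (HC Tr i c : ℝ) := by
    apply Finset.sum_le_sum_of_subset_of_nonneg
    · apply Finset.Icc_subset_Icc_right; omega
    · intro c _ _
      exact mul_nonneg (wt_nonneg ρ h0 c) (by positivity)
  have a3 : ∑ c ∈ Finset.Icc 1 n, wt ρ c * ((Cnt Tr i : ℝ) - HC Tr i c)
     + ∑ c ∈ Finset.Icc 1 n, wt ρ c * (HC Tr i c : ℝ) = (∑ c ∈ Finset.Icc 1 n, wt ρ c) * Cnt Tr i := by
    rw [← Finset.sum_add_distrib, Finset.sum_mul]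
    apply Finset.sum_congr rfl
    intros; ring
  have a4 := mul_le_mul_of_nonneg_right (sum_wt_le ρ h0 h1 hs n) (Nat.cast_nonneg (α := ℝ) (Cnt Tr i))
  linarith

theorem Tm_le (ρ : ℝ) (h0 : 0 < ρ) (h1 : ρ < 1) (hs : sigmaFn ρ = 1) (n i : ℕ) :
    Tm ρ n i ≤ Cnt Tr i * (ρ ^ (n - i) / (1 - ρ)) := by
  have a1 : ∑ c ∈ Finset.Icc 1 (n - i), wt ρ c * (HC Tr i c : ℝ)
      ≤ ∑ c ∈ Finset.Icc 1 i, wt ρ c * (HC Tr i c : ℝ) := by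
    calc _ ≤ ∑ c ∈ Finset.Icc 1 (n - i + i), wt ρ c * (HC Tr i c : ℝ) := by
          apply Finset.sum_le_sum_of_subset_of_nonneg
          · apply Finset.Icc_subset_Icc_right; omega
          · intro c _ _
            exact mul_nonneg (wt_nonneg ρ h0 c) (by positivity)
      _ = _ := by
          symm
          apply Finset.sum_subset
          · apply Finset.Icc_subset_Icc_right; omega
          · intro c _ hc
            rw [HC_eq_zero Tr i c (by tauto)]
            simp
  have a2 := mul_le_mul_of_nonneg_left (tail_wt_le ρ h0 h1 hs (n - i))
    (Nat.cast_nonneg (α := ℝ) (Cnt Tr i))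
  have a3 : ∑ c ∈ Finset.Icc 1 (n - i), wt ρ c * ((Cnt Tr i : ℝ) - HC Tr i c)
     + ∑ c ∈ Finset.Icc 1 (n - i), wt ρ c * (HC Tr i c : ℝ)
      = (∑ c ∈ Finset.Icc 1 (n - i), wt ρ c) * Cnt Tr i := by
    rw [← Finset.sum_add_distrib, Finset.sum_mul]
    apply Finset.sum_congr rfl
    intros; ring
  unfold Tm
  linarith

theorem Cnt_upper (ρ : ℝ) (h0 : 0 < ρ) (h1 : ρ < 1) (hs : sigmaFn ρ = 1) (n : ℕ) :
    (Cnt Tr n : ℝ) * ρ ^ n ≤ 2 := by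
  have hT := T_eq ρ h0 n
  have hle : ρ ^ n * Tm ρ n n ≤ 1 := by
    rw [← hT]
    apply Finset.single_le_sum (f := fun i => ρ ^ i * Tm ρ n i)
    · intro i hi
      simp at hi
      exact mul_nonneg (by positivity) (Tm_nonneg ρ h0 h1 hs n i (by omega))
    · simp
  rcases Nat.eq_zero_or_pos n with rfl | hn
  · rw [Cnt_zero]; norm_num
  have hh : (Cnt Tr n : ℝ) / 2 ≤ Tm ρ n n := by
    unfold Tm
    simp only [Nat.sub_self, Finset.Icc_eq_empty_of_lt (Nat.zero_lt_one), Finset.sum_empty, sub_zero]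
    have : ∑ c ∈ Finset.Icc 1 n, wt ρ c * (HC Tr n c : ℝ) ≤ ∑ c ∈ Finset.Icc 1 n, (1/2) * (HC Tr n c : ℝ) := by
      apply Finset.sum_le_sum
      intro c _
      apply mul_le_mul_of_nonneg_right _ (by positivity)
      have hp : 0 < ρ ^ c := by positivity
      have hp1 : ρ ^ c ≤ 1 := pow_le_one₀ h0.le h1.le
      unfold wt
      rw [div_le_div_iff₀ (by positivity) (by norm_num)]
      linarith
    rw [← Finset.mul_sum] at this
    have e : (Cnt Tr n : ℝ) = ∑ c ∈ Finset.Icc 1 n, (HC Tr n c : ℝ) := by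
      rw [Cnt_eq_sum Tr n hn]; push_cast; rfl
    rw [← e] at this
    linarith
  have hp : 0 < ρ ^ n := by positivity
  nlinarith

theorem Cnt_lower (ρ : ℝ) (h0 : 0 < ρ) (h1 : ρ < 1) (hs : sigmaFn ρ = 1) :
    ∃ c : ℝ, 0 < c ∧ ∃ n0 : ℕ, ∀ n ≥ n0, c ≤ (Cnt Tr n : ℝ) * ρ ^ n := by
  have hq : 0 < 1 - ρ := by linarith
  obtain ⟨M, hM⟩ := exists_pow_lt_of_lt_one (show 0 < (1 - ρ) ^ 2 / 4 by positivity) h1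
  refine ⟨(1 - ρ) * ρ ^ 3 / (2 * (M + 1)), by positivity, M + 3, ?_⟩
  intro m hm
  obtain ⟨n, rfl⟩ : ∃ n, m = n + 3 := ⟨m - 3, by omega⟩
  have hT := T_eq ρ h0 n
  have hb : ∀ i ∈ Finset.range (n + 1), ρ ^ i * Tm ρ n i ≤
      (if n - i < M then ρ ^ n / (1 - ρ) * Cnt Tr (n + 3) else 0) +
        (2 / (1 - ρ)) * (if M ≤ n - i then ρ ^ (n - i) else 0) := by
    intro i hi
    have hi : i ≤ n := by simp at hi; omega
    have a := Tm_le ρ h0 h1 hs n i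
    have hpi : 0 < ρ ^ i := by positivity
    have a := mul_le_mul_of_nonneg_left a hpi.le
    by_cases hc : n - i < M
    · rw [if_pos hc, if_neg (by omega)]
      have hm : (Cnt Tr i : ℝ) ≤ Cnt Tr (n + 3) := by
        have := Cnt_mono i (n + 3 - i) (by omega)
        rw [show i + (n + 3 - i) = n + 3 by omega] at this
        exact_mod_cast this
      have hp : ρ ^ n = ρ ^ i * ρ ^ (n - i) := by rw [← pow_add]; congr 1; omega
      have : ρ ^ i * (Cnt Tr i * (ρ ^ (n - i) / (1 - ρ))) = ρ ^ n / (1 - ρ) * Cnt Tr i := by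
        rw [hp]; ring
      rw [this] at a
      have := mul_le_mul_of_nonneg_left hm (show 0 ≤ ρ ^ n / (1 - ρ) by positivity)
      linarith
    · rw [if_neg hc, if_pos (by omega)]
      have u := Cnt_upper ρ h0 h1 hs i
      have : ρ ^ i * (Cnt Tr i * (ρ ^ (n - i) / (1 - ρ))) = (Cnt Tr i * ρ ^ i) * (ρ ^ (n - i) / (1 - ρ)) := by
        ring
      rw [this] at a
      have := mul_le_mul_of_nonneg_right u (show 0 ≤ ρ ^ (n - i) / (1 - ρ) by positivity)
      calc _ ≤ _ := a
        _ ≤ _ := this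
        _ = _ := by ring
  have hS := Finset.sum_le_sum hb
  rw [hT, Finset.sum_add_distrib, ← Finset.mul_sum] at hS
  have r1 : ∑ i ∈ Finset.range (n + 1), (if n - i < M then ρ ^ n / (1 - ρ) * (Cnt Tr (n + 3) : ℝ) else 0)
      ≤ M * (ρ ^ n / (1 - ρ) * (Cnt Tr (n + 3) : ℝ)) := by
    rw [← Finset.sum_range_reflect, ← Finset.sum_filter, Finset.sum_const, nsmul_eq_mul]
    apply mul_le_mul_of_nonneg_right _ (by positivity)
    norm_cast
    calc _ ≤ (Finset.range M).card := by
          apply Finset.card_le_card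
          intro j
          simp only [Finset.mem_filter, Finset.mem_range]
          omega
      _ = M := by simp
  have r2 : ∑ i ∈ Finset.range (n + 1), (if M ≤ n - i then ρ ^ (n - i) else 0)
      ≤ ρ ^ M / (1 - ρ) := by
    have e : ∑ i ∈ Finset.range (n + 1), (if M ≤ n - i then ρ ^ (n - i) else 0)
      = ∑ i ∈ Finset.range (n + 1), (if M ≤ i then ρ ^ i else 0) :=
        Finset.sum_range_reflect (fun i => if M ≤ i then ρ ^ i else 0) (n + 1)
    rw [e, ← Finset.sum_filter]
    have e2 : (Finset.range (n + 1)).filter (fun i => M ≤ i) = Finset.Ico M (n + 1) := by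
      ext j; simp; omega
    rw [e2, Finset.sum_Ico_eq_sum_range]
    have g := (hasSum_geometric_of_lt_one h0.le h1).mul_left (ρ ^ M)
    rw [← div_eq_mul_inv] at g
    simp only [pow_add]
    exact sum_le_hasSum _ (fun i _ => by positivity) g
  have r3 := mul_le_mul_of_nonneg_left r2 (show 0 ≤ 2 / (1 - ρ) by positivity)
  have r4 : 2 / (1 - ρ) * (ρ ^ M / (1 - ρ)) ≤ 1 / 2 := by
    rw [div_mul_div_comm, div_le_div_iff₀ (by positivity) (by norm_num)]
    nlinarith
  have r5 : 1 / 2 ≤ M * (ρ ^ n / (1 - ρ) * (Cnt Tr (n + 3) : ℝ)) := by linarith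
  have r6 : M * (ρ ^ n / (1 - ρ) * (Cnt Tr (n + 3) : ℝ))
      ≤ (M + 1) * (ρ ^ n / (1 - ρ) * (Cnt Tr (n + 3) : ℝ)) :=
    mul_le_mul_of_nonneg_right (by linarith) (by positivity)
  have r7 := r5.trans r6
  rw [div_le_iff₀ (by positivity)]
  have : (M + 1) * (ρ ^ n / (1 - ρ) * (Cnt Tr (n + 3) : ℝ))
    = ((M + 1) * (ρ ^ n * (Cnt Tr (n + 3) : ℝ))) / (1 - ρ) := by ring
  rw [this, div_le_div_iff₀ (by norm_num) hq] at r7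
  have hp3 : 0 < ρ ^ 3 := by positivity
  rw [pow_add]
  nlinarith

noncomputable def Has (n k : ℕ) : ℕ := ((OmF Tr n).filter (fun L => k ∈ L)).card

theorem Has_add (n k : ℕ) : Has n k + Cnt (fun x => x ≠ k) n = Cnt Tr n := by
  have : Cnt (fun x => x ≠ k) n = ((OmF Tr n).filter (fun L => ¬ k ∈ L)).card := by
    unfold Cnt
    congr 1
    ext L
    simp only [Finset.mem_filter, mem_OmF]
    constructor
    · rintro ⟨h1, h2⟩
      exact ⟨⟨h1, fun _ _ => trivial⟩, fun h => h2 k h rfl⟩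
    · rintro ⟨⟨h1, -⟩, h2⟩
      exact ⟨h1, fun x hx h => h2 (h ▸ hx)⟩
  rw [this]
  exact Finset.card_filter_add_card_filter_not _

theorem Has_le (n k : ℕ) (hk : k ≤ n) :
    Has n k ≤ ∑ p ∈ Finset.HasAntidiagonal.antidiagonal (n - k), Cnt Tr p.1 * Cnt Tr p.2 := by
  unfold Has Cnt
  have : (OmF Tr n).filter (fun L => k ∈ L) ⊆
      (Finset.HasAntidiagonal.antidiagonal (n - k)).biUnion (fun p => (OmF Tr p.1 ×ˢ OmF Tr p.2).image
        (fun q => q.1 ++ k :: q.2)) := by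
    intro L hL
    rw [Finset.mem_filter, mem_OmF] at hL
    obtain ⟨⟨⟨⟨h1, h2⟩, h3⟩, -⟩, h5⟩ := hL
    obtain ⟨s, t, rfl⟩ := List.append_of_mem h5
    rw [List.isChain_append] at h3
    obtain ⟨c1, c2, -⟩ := h3
    rw [List.isChain_cons] at c2
    rw [List.sum_append, List.sum_cons] at h2
    simp only [Finset.mem_biUnion, Finset.mem_image, Finset.mem_product, mem_OmF,
      Finset.HasAntidiagonal.mem_antidiagonal]
    refine ⟨(s.sum, t.sum), by dsimp only; omega, (s, t), ⟨⟨⟨⟨?_, rfl⟩, c1⟩, fun _ _ => trivial⟩,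
      ⟨⟨⟨?_, rfl⟩, c2.2⟩, fun _ _ => trivial⟩⟩, rfl⟩
    · intro x hx; exact h1 x (by simp at hx ⊢; tauto)
    · intro x hx; exact h1 x (by simp at hx ⊢; tauto)
  refine (Finset.card_le_card this).trans (Finset.card_biUnion_le.trans ?_)
  apply Finset.sum_le_sum
  intro p _
  refine Finset.card_image_le.trans ?_
  rw [Finset.card_product]

theorem Has_upper (ρ : ℝ) (h0 : 0 < ρ) (h1 : ρ < 1) (hs : sigmaFn ρ = 1) (n k : ℕ)
    (hk : k ∈ Finset.Icc 1 n) : (Has n k : ℝ) * ρ ^ n ≤ 4 * n * ρ ^ k := by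
  rw [Finset.mem_Icc] at hk
  have h : (Has n k : ℝ) ≤ ∑ p ∈ Finset.HasAntidiagonal.antidiagonal (n - k), (Cnt Tr p.1 : ℝ) * Cnt Tr p.2 := by
    exact_mod_cast Has_le n k hk.2
  have hp : 0 < ρ ^ n := by positivity
  refine (mul_le_mul_of_nonneg_right h hp.le).trans ?_
  rw [Finset.sum_mul]
  have hb : ∀ p ∈ Finset.HasAntidiagonal.antidiagonal (n - k), (Cnt Tr p.1 : ℝ) * Cnt Tr p.2 * ρ ^ n ≤ 4 * ρ ^ k := by
    intro p hp
    rw [Finset.HasAntidiagonal.mem_antidiagonal] at hp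
    have e : ρ ^ n = ρ ^ p.1 * ρ ^ p.2 * ρ ^ k := by
      rw [← pow_add, ← pow_add]; congr 1; omega
    have u1 := Cnt_upper ρ h0 h1 hs p.1
    have u2 := Cnt_upper ρ h0 h1 hs p.2
    have := mul_le_mul u1 u2 (by positivity) (by norm_num)
    calc _ = ((Cnt Tr p.1 : ℝ) * ρ ^ p.1 * (Cnt Tr p.2 * ρ ^ p.2)) * ρ ^ k := by rw [e]; ring
      _ ≤ (2 * 2) * ρ ^ k := mul_le_mul_of_nonneg_right this (by positivity)
      _ = _ := by ring
  refine (Finset.sum_le_card_nsmul _ _ _ hb).trans ?_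
  rw [Finset.Nat.card_antidiagonal, nsmul_eq_mul]
  have : ((n - k + 1 : ℕ) : ℝ) ≤ n := by exact_mod_cast (by omega)
  have := mul_le_mul_of_nonneg_right this (show 0 ≤ 4 * ρ ^ k by positivity)
  linarith

theorem carlitzCount_eq_s12 (n : ℕ) : carlitzCount n = Cnt Tr n := by
  unfold carlitzCount Cnt
  apply Nat.subtype_card
  intro L
  simp [OmF, OmS, Tr]

theorem avg_eq (n : ℕ) : avgDistinct n = ∑ k ∈ Finset.Icc 1 n, (Has n k : ℝ) / Cnt Tr n := by
  unfold avgDistinct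
  rw [carlitzCount_eq_s12, ← Finset.sum_div]
  congr 1
  have hset : ∀ L : List ℕ, (IsComposition n L ∧ IsCarlitz L) ↔ L ∈ OmF Tr n := by
    intro L; simp [OmF, OmS, Tr]
  have e1 : (∑ᶠ γ : {L : List ℕ // IsComposition n L ∧ IsCarlitz L}, (distinctCount (γ : List ℕ) : ℝ))
      = ∑ L ∈ OmF Tr n, (distinctCount L : ℝ) := by
    have := finsum_set_coe_eq_finsum_mem (f := fun L : List ℕ => (distinctCount L : ℝ))
      {L | IsComposition n L ∧ IsCarlitz L}
    refine this.trans ?_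
    rw [← finsum_mem_finset_eq_sum]
    simp only [Set.mem_ofPred_eq, hset]
  rw [e1]
  have e2 : ∀ L ∈ OmF Tr n, (distinctCount L : ℝ) = ∑ k ∈ Finset.Icc 1 n, if k ∈ L then (1 : ℝ) else 0 := by
    intro L hL
    rw [mem_OmF] at hL
    obtain ⟨⟨⟨h1, h2⟩, -⟩, -⟩ := hL
    rw [← Finset.sum_filter, Finset.sum_const, nsmul_eq_mul, mul_one]
    unfold distinctCount
    rw [← List.card_toFinset]
    congr 2
    ext k
    simp only [List.mem_toFinset, Finset.mem_filter, Finset.mem_Icc]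
    refine ⟨fun h => ⟨⟨h1 k h, ?_⟩, h⟩, fun h => h.2⟩
    have := List.le_sum_of_mem h
    omega
  rw [Finset.sum_congr rfl e2, Finset.sum_comm]
  apply Finset.sum_congr rfl
  intro k _
  rw [← Finset.sum_filter, Finset.sum_const, nsmul_eq_mul, mul_one]
  rfl

theorem miss_bound (ρ : ℝ) (h0 : 0 < ρ) (h1 : ρ < 1) (hs : sigmaFn ρ = 1) (n k : ℕ)
    (hk : k ∈ Finset.Icc 1 n) :
    (Cnt (fun x => x ≠ k) n : ℝ) * ρ ^ n * (1 + (1 - ρ) ^ 2 / 8 * ρ ^ k) ^ n ≤ 4 / ρ ^ k := by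
  have hq : 0 < 1 - ρ := by linarith
  have hpk : 0 < ρ ^ k := by positivity
  have hpk1 : ρ ^ k ≤ 1 := pow_le_one₀ h0.le h1.le
  set z : ℝ := ρ + ρ ^ k * (1 - ρ) ^ 2 / 8 with hz
  have hzρ : ρ ≤ z := by
    have : 0 ≤ ρ ^ k * (1 - ρ) ^ 2 / 8 := by positivity
    linarith
  have hz0 : 0 < z := by linarith
  have hz1 : (1 - ρ) / 2 ≤ 1 - z := by
    have : ρ ^ k * (1 - ρ) ^ 2 ≤ 1 * (1 - ρ) ^ 2 := mul_le_mul_of_nonneg_right hpk1 (by positivity)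
    rw [hz]; nlinarith
  have hzlt : z < 1 := by linarith
  have hsum : ∑ b ∈ (Finset.Icc 1 n).filter (fun x => x ≠ k), wt z b ≤ 1 - ρ ^ k / 4 := by
    have s1 : ∑ b ∈ (Finset.Icc 1 n).filter (fun x => x ≠ k), wt z b
        ≤ ∑ b ∈ (Finset.Icc 1 n).filter (fun x => x ≠ k), wt ρ b
          + ∑ b ∈ (Finset.Icc 1 n).filter (fun x => x ≠ k), (z ^ b - ρ ^ b) := by
      rw [← Finset.sum_add_distrib]
      apply Finset.sum_le_sum
      intro b _
      have a1 : 0 < ρ ^ b := by positivity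
      have a2 : ρ ^ b ≤ z ^ b := pow_le_pow_left₀ h0.le hzρ b
      unfold wt
      have : z ^ b / (1 + z ^ b) - ρ ^ b / (1 + ρ ^ b)
          = (z ^ b - ρ ^ b) / ((1 + z ^ b) * (1 + ρ ^ b)) := by
        have : 0 < z ^ b := by positivity
        field_simp
        ring
      have : (z ^ b - ρ ^ b) / ((1 + z ^ b) * (1 + ρ ^ b)) ≤ z ^ b - ρ ^ b := by
        apply div_le_self (by linarith)
        nlinarith
      linarith
    have s2 : ∑ b ∈ (Finset.Icc 1 n).filter (fun x => x ≠ k), wt ρ b ≤ 1 - ρ ^ k / 2 := by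
      have := sum_wt_le ρ h0 h1 hs n
      rw [Finset.filter_ne', ]
      rw [← Finset.add_sum_erase _ _ hk] at this
      have : ρ ^ k / 2 ≤ wt ρ k := by
        unfold wt
        exact div_le_div_of_nonneg_left hpk.le (by positivity) (by linarith)
      linarith
    have s3 : ∑ b ∈ (Finset.Icc 1 n).filter (fun x => x ≠ k), (z ^ b - ρ ^ b) ≤ ρ ^ k / 4 := by
      have g := (hasSum_geometric_of_lt_one hz0.le hzlt).sub (hasSum_geometric_of_lt_one h0.le h1)
      have := sum_le_hasSum ((Finset.Icc 1 n).filter (fun x => x ≠ k))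
        (fun b _ => sub_nonneg.2 (pow_le_pow_left₀ h0.le hzρ b)) g
      refine this.trans ?_
      have e : (1 - z)⁻¹ - (1 - ρ)⁻¹ = (z - ρ) / ((1 - z) * (1 - ρ)) := by
        have : 1 - z ≠ 0 := by linarith
        have : 1 - ρ ≠ 0 := hq.ne'
        field_simp
        ring
      rw [e, div_le_iff₀ (mul_pos (by linarith) hq)]
      have e2 : z - ρ = ρ ^ k / 4 * ((1 - ρ) / 2 * (1 - ρ)) := by rw [hz]; ring
      rw [e2]
      apply mul_le_mul_of_nonneg_left _ (by positivity)
      exact mul_le_mul_of_nonneg_right hz1 hq.le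
    linarith
  have hb := Cnt_bound (fun x => x ≠ k) z hz0 n (ρ ^ k / 4) (by positivity) hsum
  rw [one_div_div] at hb
  refine le_trans ?_ hb
  rw [mul_assoc, ← mul_pow]
  apply mul_le_mul_of_nonneg_left _ (by positivity)
  apply pow_le_pow_left₀ (by positivity)
  have : 0 ≤ ρ ^ k * (1 - ρ) ^ 2 / 8 := by positivity
  rw [hz]
  nlinarith

theorem avg_upper (ρ : ℝ) (h0 : 0 < ρ) (h1 : ρ < 1) (hs : sigmaFn ρ = 1) :
    ∃ C : ℝ, ∃ n0 : ℕ, ∀ n ≥ n0, avgDistinct n ≤ Real.log n / Real.log (1 / ρ) + C := by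
  obtain ⟨c, hc, n0, hn0⟩ := Cnt_lower ρ h0 h1 hs
  have hq : 0 < 1 - ρ := by linarith
  have hlam : 0 < Real.log (1 / ρ) := Real.log_pos (by rw [lt_div_iff₀ h0]; linarith)
  refine ⟨1 + (4 / c) * (1 / (1 - ρ)), max n0 1, fun n hn => ?_⟩
  have hn1 : 1 ≤ n := le_trans (le_max_right _ _) hn
  have hlow := hn0 n (le_trans (le_max_left _ _) hn)
  have hnr : (1 : ℝ) ≤ n := by exact_mod_cast hn1
  have hpn : 0 < ρ ^ n := by positivity
  have hcnt : 0 < (Cnt Tr n : ℝ) := by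
    by_contra hcon
    have : (Cnt Tr n : ℝ) * ρ ^ n ≤ 0 := mul_nonpos_of_nonpos_of_nonneg (not_lt.1 hcon) hpn.le
    linarith
  set K : ℕ := ⌈Real.log n / Real.log (1 / ρ)⌉₊ with hK
  have hlogn : 0 ≤ Real.log n := Real.log_nonneg hnr
  have hK1 : (K : ℝ) ≤ Real.log n / Real.log (1 / ρ) + 1 := (Nat.ceil_lt_add_one (by positivity)).le
  have hK2 : n * ρ ^ K ≤ 1 := by
    have : Real.log n / Real.log (1 / ρ) ≤ K := Nat.le_ceil _
    rw [div_le_iff₀ hlam] at this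
    have h2 : (n : ℝ) ≤ (1 / ρ) ^ K := by
      rw [← Real.log_le_log_iff (by linarith) (by positivity), Real.log_pow]
      exact this
    rw [one_div, inv_pow] at h2
    have := mul_le_mul_of_nonneg_right h2 (show 0 ≤ ρ ^ K by positivity)
    rwa [inv_mul_cancel₀ (by positivity)] at this
  rw [avg_eq]
  have hb : ∀ k ∈ Finset.Icc 1 n, (Has n k : ℝ) / Cnt Tr n ≤
      (if k ≤ K then 1 else 0) + (4 / c) * (if K ≤ k then ρ ^ (k - K) else 0) := by
    intro k hk
    by_cases hkK : k ≤ K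
    · rw [if_pos hkK]
      have : (Has n k : ℝ) / Cnt Tr n ≤ 1 := by
        rw [div_le_one hcnt]
        have := Has_add n k
        exact_mod_cast (by omega)
      have : 0 ≤ (4 / c) * (if K ≤ k then ρ ^ (k - K) else 0) := by
        split_ifs <;> positivity
      linarith
    · rw [if_neg hkK, if_pos (by omega), zero_add]
      have hu := Has_upper ρ h0 h1 hs n k hk
      have e : (Has n k : ℝ) / Cnt Tr n = (Has n k * ρ ^ n) / (Cnt Tr n * ρ ^ n) := by
        field_simp
      rw [e]
      calc _ ≤ (4 * n * ρ ^ k) / c := div_le_div₀ (by positivity) hu hc hlow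
        _ = (4 / c) * ((n * ρ ^ K) * ρ ^ (k - K)) := by
            have : ρ ^ k = ρ ^ K * ρ ^ (k - K) := by rw [← pow_add]; congr 1; omega
            rw [this]; ring
        _ ≤ (4 / c) * (1 * ρ ^ (k - K)) := by
            apply mul_le_mul_of_nonneg_left _ (by positivity)
            exact mul_le_mul_of_nonneg_right hK2 (by positivity)
        _ = _ := by ring
  refine (Finset.sum_le_sum hb).trans ?_
  rw [Finset.sum_add_distrib, ← Finset.mul_sum]
  have r1 : ∑ k ∈ Finset.Icc 1 n, (if k ≤ K then (1 : ℝ) else 0) ≤ K := by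
    rw [← Finset.sum_filter, Finset.sum_const, nsmul_eq_mul, mul_one]
    norm_cast
    calc _ ≤ (Finset.Icc 1 K).card := by
          apply Finset.card_le_card
          intro j; simp only [Finset.mem_filter, Finset.mem_Icc]; omega
      _ = K := by simp
  have r2 : ∑ k ∈ Finset.Icc 1 n, (if K ≤ k then ρ ^ (k - K) else 0) ≤ 1 / (1 - ρ) := by
    rw [← Finset.sum_filter]
    calc _ ≤ ∑ k ∈ Finset.Ico K (n + 1), ρ ^ (k - K) := by
          apply Finset.sum_le_sum_of_subset_of_nonneg
          · intro j; simp only [Finset.mem_filter, Finset.mem_Icc, Finset.mem_Ico]; omega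
          · intros; positivity
      _ = ∑ k ∈ Finset.range (n + 1 - K), ρ ^ k := by
          rw [Finset.sum_Ico_eq_sum_range]
          apply Finset.sum_congr rfl
          intro i _; congr 1; omega
      _ ≤ _ := by
          rw [one_div]
          exact sum_le_hasSum _ (fun i _ => by positivity) (hasSum_geometric_of_lt_one h0.le h1)
  have r3 := mul_le_mul_of_nonneg_left r2 (show 0 ≤ 4 / c by positivity)
  linarith

/-- error term in the lower bound -/
noncomputable def eta (κ c θ : ℝ) (n : ℕ) : ℝ :=
  4 / c * ((n : ℝ) * Real.exp (-(κ / 2) * (n : ℝ) ^ (1 - θ)))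

theorem eta_tendsto (κ c θ : ℝ) (hκ : 0 < κ) (hθ : θ < 1) :
    Tendsto (eta κ c θ) atTop (nhds 0) := by
  have hε : 0 < 1 - θ := by linarith
  have t := tendsto_rpow_mul_exp_neg_mul_atTop_nhds_zero (1 / (1 - θ)) (κ / 2) (by positivity)
  have t2 : Tendsto (fun n : ℕ => (n : ℝ) ^ (1 - θ)) atTop atTop :=
    (tendsto_rpow_atTop hε).comp tendsto_natCast_atTop_atTop
  have t3 := (t.comp t2).const_mul (4 / c)
  rw [mul_zero] at t3
  refine t3.congr ?_
  intro n
  simp only [Function.comp, eta]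
  rw [← Real.rpow_mul (by positivity), mul_one_div_cancel hε.ne', Real.rpow_one]

theorem avg_lower (ρ : ℝ) (h0 : 0 < ρ) (h1 : ρ < 1) (hs : sigmaFn ρ = 1) (θ : ℝ) (hθ0 : 0 < θ)
    (hθ : θ < 1) :
    ∃ κ c : ℝ, 0 < κ ∧ ∀ᶠ n : ℕ in atTop,
      (θ * Real.log n / Real.log (1 / ρ) - 1) * (1 - eta κ c θ n) ≤ avgDistinct n := by
  obtain ⟨c, hc, n0, hn0⟩ := Cnt_lower ρ h0 h1 hs
  have hq : 0 < 1 - ρ := by linarith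
  have hlam : 0 < Real.log (1 / ρ) := Real.log_pos (by rw [lt_div_iff₀ h0]; linarith)
  set κ : ℝ := (1 - ρ) ^ 2 / 8 with hκ
  have hκ0 : 0 < κ := by positivity
  have hκ1 : κ ≤ 1 := by rw [hκ]; nlinarith
  refine ⟨κ, c, hκ0, ?_⟩
  have ev1 : ∀ᶠ n : ℕ in atTop, Real.log n ≤ Real.log (1 / ρ) * n := by
    have := (Real.isLittleO_log_id_atTop.comp_tendsto tendsto_natCast_atTop_atTop).def hlam
    filter_upwards [this] with n hn
    simp only [Function.comp, id, Real.norm_eq_abs, Nat.abs_cast] at hn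
    exact (le_abs_self _).trans hn
  have ev2 : ∀ᶠ n : ℕ in atTop, eta κ c θ n < 1 :=
    (eta_tendsto κ c θ hκ0 hθ).eventually_lt_const one_pos
  filter_upwards [ev1, ev2, eventually_ge_atTop n0, eventually_ge_atTop 1] with n hlin heta hnn0 hn1
  have hlow := hn0 n hnn0
  have hnr : (1 : ℝ) ≤ n := by exact_mod_cast hn1
  have hpn : 0 < ρ ^ n := by positivity
  have hcnt : 0 < (Cnt Tr n : ℝ) := by
    by_contra hcon
    have : (Cnt Tr n : ℝ) * ρ ^ n ≤ 0 := mul_nonpos_of_nonpos_of_nonneg (not_lt.1 hcon) hpn.le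
    linarith
  have hlogn : 0 ≤ Real.log n := Real.log_nonneg hnr
  set K : ℕ := ⌊θ * Real.log n / Real.log (1 / ρ)⌋₊ with hK
  have hK1 : θ * Real.log n / Real.log (1 / ρ) - 1 ≤ K := (Nat.sub_one_lt_floor _).le
  have hK2 : (K : ℝ) ≤ θ * Real.log n / Real.log (1 / ρ) := Nat.floor_le (by positivity)
  rw [le_div_iff₀ hlam] at hK2
  have hKn : K ≤ n := by
    have a : (K : ℝ) * Real.log (1 / ρ) ≤ n * Real.log (1 / ρ) := by nlinarith
    exact_mod_cast le_of_mul_le_mul_right a hlam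
  set y : ℝ := Real.exp (-(θ * Real.log n)) with hy
  have hy0 : 0 < y := Real.exp_pos _
  have hy1 : y ≤ 1 := by
    rw [hy, Real.exp_le_one_iff]
    have : 0 ≤ θ * Real.log n := by positivity
    linarith
  have hny : n * y = (n : ℝ) ^ (1 - θ) := by
    rw [Real.rpow_def_of_pos (by linarith), hy]
    nth_rewrite 1 [← Real.exp_log (show (0 : ℝ) < n by linarith)]
    rw [← Real.exp_add]; congr 1; ring
  have hinv : 1 / y ≤ n := by
    rw [hy, Real.exp_neg, one_div, inv_inv]
    calc Real.exp (θ * Real.log n) ≤ Real.exp (Real.log n) := by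
          apply Real.exp_le_exp.2; nlinarith
      _ = n := Real.exp_log (by linarith)
  have hexp : Real.exp (κ / 2 * (n : ℝ) ^ (1 - θ)) ≤ (1 + κ * y) ^ n := by
    have e : Real.exp (κ * y / 2) ≤ 1 + κ * y := by
      have hx0 : 0 < κ * y := by positivity
      have hx1 : κ * y ≤ 1 := by nlinarith
      have := Real.exp_bound_div_one_sub_of_interval (x := κ * y / 2) (by positivity) (by linarith)
      refine this.trans ?_
      rw [div_le_iff₀ (by linarith)]
      nlinarith
    calc _ = Real.exp (κ * y / 2) ^ n := by
          rw [← Real.exp_nat_mul, ← hny]; congr 1; ring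
      _ ≤ _ := pow_le_pow_left₀ (Real.exp_pos _).le e n
  have hbk : ∀ k ∈ Finset.Icc 1 K, 1 - eta κ c θ n ≤ (Has n k : ℝ) / Cnt Tr n := by
    intro k hk
    rw [Finset.mem_Icc] at hk
    have hm := miss_bound ρ h0 h1 hs n k (Finset.mem_Icc.2 ⟨hk.1, by omega⟩)
    rw [← hκ] at hm
    have hyk : y ≤ ρ ^ k := by
      rw [hy, ← Real.exp_log (show 0 < ρ ^ k by positivity), Real.exp_le_exp, Real.log_pow]
      have : (k : ℝ) ≤ K := by exact_mod_cast hk.2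
      have := mul_le_mul_of_nonneg_right this hlam.le
      rw [one_div, Real.log_inv] at *
      linarith
    have m1 : (Cnt (fun x => x ≠ k) n : ℝ) * ρ ^ n * Real.exp (κ / 2 * (n : ℝ) ^ (1 - θ)) ≤ 4 * n := by
      calc _ ≤ (Cnt (fun x => x ≠ k) n : ℝ) * ρ ^ n * (1 + κ * ρ ^ k) ^ n := by
            apply mul_le_mul_of_nonneg_left _ (by positivity)
            refine hexp.trans (pow_le_pow_left₀ (by positivity) ?_ n)
            have := mul_le_mul_of_nonneg_left hyk hκ0.le
            linarith
        _ ≤ 4 / ρ ^ k := hm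
        _ ≤ 4 / y := div_le_div_of_nonneg_left (by norm_num) hy0 hyk
        _ = 4 * (1 / y) := by ring
        _ ≤ 4 * n := by linarith
    have m2 : (Cnt (fun x => x ≠ k) n : ℝ) / Cnt Tr n ≤ eta κ c θ n := by
      have e : (Cnt (fun x => x ≠ k) n : ℝ) / Cnt Tr n
          = (Cnt (fun x => x ≠ k) n * ρ ^ n) / (Cnt Tr n * ρ ^ n) := by
        field_simp
      rw [e]
      have m3 : (Cnt (fun x => x ≠ k) n : ℝ) * ρ ^ n
          ≤ 4 * n * Real.exp (-(κ / 2) * (n : ℝ) ^ (1 - θ)) := by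
        rw [neg_mul, Real.exp_neg, ← div_eq_mul_inv, le_div_iff₀ (Real.exp_pos _)]
        exact m1
      calc _ ≤ (4 * n * Real.exp (-(κ / 2) * (n : ℝ) ^ (1 - θ))) / c :=
            div_le_div₀ (by positivity) m3 hc hlow
        _ = _ := by unfold eta; ring
    have m4 : (Has n k : ℝ) = Cnt Tr n - Cnt (fun x => x ≠ k) n := by
      rw [← Has_add n k]; push_cast; ring
    rw [m4, sub_div, div_self hcnt.ne']
    linarith
  rw [avg_eq]
  calc _ ≤ (K : ℝ) * (1 - eta κ c θ n) := mul_le_mul_of_nonneg_right hK1 (by linarith)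
    _ ≤ ∑ k ∈ Finset.Icc 1 K, (Has n k : ℝ) / Cnt Tr n := by
        have := Finset.card_nsmul_le_sum _ _ _ hbk
        simpa using this
    _ ≤ _ := by
        apply Finset.sum_le_sum_of_subset_of_nonneg
        · exact Finset.Icc_subset_Icc_right hKn
        · intros; positivity

/-- With `ρ` the unique solution of `σ(z) = 1` in `(0,1)`,
`E D_n / ln n → 1/ln(1/ρ)` as `n → ∞`. -/
theorem avg_distinct_parts_div_log (ρ : ℝ)
    (hρ : ρ ∈ Set.Ioo (0 : ℝ) 1 ∧ sigmaFn ρ = 1)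
    (hρu : ∀ x ∈ Set.Ioo (0 : ℝ) 1, sigmaFn x = 1 → x = ρ) :
    Tendsto (fun n : ℕ => avgDistinct n / Real.log n)
      atTop (nhds (1 / Real.log (1 / ρ))) := by
  obtain ⟨⟨h0, h1⟩, hs⟩ := hρ
  have hlam : 0 < Real.log (1 / ρ) := Real.log_pos (by rw [lt_div_iff₀ h0]; linarith)
  set lam := Real.log (1 / ρ) with hl
  have tlog : Tendsto (fun n : ℕ => Real.log n) atTop atTop :=
    Real.tendsto_log_atTop.comp tendsto_natCast_atTop_atTop
  have tinv : Tendsto (fun n : ℕ => (Real.log n)⁻¹) atTop (nhds 0) :=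
    tendsto_inv_atTop_zero.comp tlog
  have evpos : ∀ᶠ n : ℕ in atTop, 0 < Real.log n := tlog.eventually_gt_atTop 0
  rw [tendsto_order]
  constructor
  · intro a ha
    have hal : max (a * lam) 0 < 1 := by
      rw [lt_div_iff₀ hlam] at ha
      exact max_lt ha one_pos
    obtain ⟨θ, hθa, hθ1⟩ := exists_between hal
    have hθ0 : 0 < θ := lt_of_le_of_lt (le_max_right _ _) hθa
    have haθ : a < θ / lam := by
      rw [lt_div_iff₀ hlam]; exact lt_of_le_of_lt (le_max_left _ _) hθa
    obtain ⟨κ, c, hκ, hev⟩ := avg_lower ρ h0 h1 hs θ hθ0 hθ1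
    have t : Tendsto (fun n : ℕ => (θ / lam - (Real.log n)⁻¹) * (1 - eta κ c θ n)) atTop
        (nhds (θ / lam)) := by
      have := (tinv.const_sub (θ / lam)).mul ((eta_tendsto κ c θ hκ hθ1).const_sub 1)
      simpa using this
    filter_upwards [hev, evpos, t.eventually_const_lt haθ] with n hn hp hlt
    refine hlt.trans_le ?_
    rw [le_div_iff₀ hp]
    refine le_trans (le_of_eq ?_) hn
    rw [← hl]
    field_simp
  · intro a ha
    obtain ⟨C, n0, hC⟩ := avg_upper ρ h0 h1 hs
    have t : Tendsto (fun n : ℕ => 1 / lam + C * (Real.log n)⁻¹) atTop (nhds (1 / lam)) := by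
      have := (tinv.const_mul C).const_add (1 / lam)
      simpa using this
    filter_upwards [evpos, eventually_ge_atTop n0, t.eventually_lt_const ha] with n hp hn hlt
    refine lt_of_le_of_lt ?_ hlt
    rw [div_le_iff₀ hp]
    refine (hC n hn).trans (le_of_eq ?_)
    rw [← hl]
    field_simp
end
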